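/- arXiv:2406.16618 — 2 statements merged into one kernel-verified Lean document; each statement's English description precedes it below -/
import Mathlib

section
/- For every even integer n ≥ 32 there exists a strictly critical snark of order n. -/
/-- The colour set `K = (ℤ₂ × ℤ₂) ∖ {(0,0)}`. -/
abbrev Kol : Type := {x : ZMod 2 × ZMod 2 // x ≠ 0}

/-- A proper edge colouring: distinct edges sharing a vertex get distinct colours. -/
def IsProperEdgeColoring {V C : Type*} (G : SimpleGraph V) (f : Sym2 V → C) : Prop :=
  ∀ e₁ ∈ G.edgeSet, ∀ e₂ ∈ G.edgeSet, e₁ ≠ e₂ → (∃ v : V, v ∈ e₁ ∧ v ∈ e₂) → f e₁ ≠ f e₂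

/-- A graph is 3-edge-colourable if it has a proper edge colouring with three colours. -/
def ThreeEdgeColorable {V : Type*} (G : SimpleGraph V) : Prop :=
  ∃ f : Sym2 V → Kol, IsProperEdgeColoring G f

/-- A graph is cubic if every vertex has degree 3. -/
def IsCubic {V : Type*} (G : SimpleGraph V) : Prop :=
  ∀ v : V, (G.neighborSet v).ncard = 3

/-- A snark: a connected cubic simple graph which is not 3-edge-colourable. -/
def IsSnark {V : Type*} (G : SimpleGraph V) : Prop :=
  G.Connected ∧ IsCubic G ∧ ¬ ThreeEdgeColorable G

/-- A snark is critical if removing any two distinct adjacent vertices yields a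
3-edge-colourable graph. -/
def Critical {V : Type*} (G : SimpleGraph V) : Prop :=
  ∀ u v : V, G.Adj u v → ThreeEdgeColorable (G.induce ({u, v}ᶜ : Set V))

/-- A snark is bicritical if removing any two distinct vertices yields a
3-edge-colourable graph. -/
def Bicritical {V : Type*} (G : SimpleGraph V) : Prop :=
  ∀ u v : V, u ≠ v → ThreeEdgeColorable (G.induce ({u, v}ᶜ : Set V))

/-- Strictly critical: critical but not bicritical. -/
def StrictlyCritical {V : Type*} (G : SimpleGraph V) : Prop :=
  Critical G ∧ ¬ Bicritical G

/-- A cubic graph is cyclically `k`-connected if no set of fewer than `k` edges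
separates two cycles, i.e. there is no set `F` of fewer than `k` edges whose deletion
leaves a graph in which two connected components contain a cycle. -/
def CyclicallyConnected {V : Type*} (G : SimpleGraph V) (k : ℕ) : Prop :=
  ¬ ∃ F : Set (Sym2 V), F ⊆ G.edgeSet ∧ F.ncard < k ∧
    ∃ a b : V, (∃ w : (G.deleteEdges F).Walk a a, w.IsCycle) ∧
               (∃ w : (G.deleteEdges F).Walk b b, w.IsCycle) ∧
               ¬ (G.deleteEdges F).Reachable a b

/-- The cyclic connectivity of a cubic graph: the largest `k` (at most the number of
edges) such that the graph is cyclically `k`-connected. -/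
noncomputable def cyclicConnectivity {V : Type*} (G : SimpleGraph V) : ℕ :=
  sSup {k | k ≤ G.edgeSet.ncard ∧ CyclicallyConnected G k}


/-! ### Cubic graphs described by edge labels

A function `T : ℕ → Fin 3 → ℕ` lists, for each vertex, the labels of its three edge ends; two
vertices are adjacent when they share a label. The first `n` vertices form a *pole* whose labels
below `m` are edges and whose labels `m, …, m + k - 1` are dangling edges. -/

/-- The first `n` vertices of `T` form a connected cubic multipole with inner edges `0, …, m - 1`
and dangling edges `m, …, m + k - 1`. -/
structure IsPole (T : ℕ → Fin 3 → ℕ) (n m k : ℕ) : Prop where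
  lt : ∀ v < n, ∀ s, T v s < m + k
  inj : ∀ v < n, ∀ s t, T v s = T v t → s = t
  two : ∀ u < n, ∀ v < n, ∀ w < n, ∀ s t r, T u s = T v t → T v t = T w r →
    u = v ∨ v = w ∨ u = w
  inner : ∀ v < n, ∀ s, T v s < m → ∃ w < n, w ≠ v ∧ ∃ t, T w t = T v s
  outer_exists : ∀ i < k, ∃ v < n, ∃ s, T v s = m + i
  outer_unique : ∀ u < n, ∀ v < n, ∀ s t, m ≤ T u s → T u s = T v t → u = v
  simple : ∀ u < n, ∀ v < n, ∀ s t s' t', T u s = T v t → T u s' = T v t' → u = v ∨ s = s'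
  conn : ∀ v < n, 0 < v → ∃ w < v, ∃ s t, T v s = T w t

/-- The colouring `c` of the labels is proper at each of the first `n` vertices outside `S`. -/
def Colors (T : ℕ → Fin 3 → ℕ) (n : ℕ) (S : List ℕ) (c : ℕ → Fin 3) : Prop :=
  ∀ v < n, v ∉ S → ∀ s t, s ≠ t → c (T v s) ≠ c (T v t)

instance (T : ℕ → Fin 3 → ℕ) (n : ℕ) (S : List ℕ) (c : ℕ → Fin 3) : Decidable (Colors T n S c) :=
  inferInstanceAs (Decidable (∀ v < n, v ∉ S → ∀ s t, s ≠ t → c (T v s) ≠ c (T v t)))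

/-- The graph on the first `n` vertices of `T`. -/
def poleGraph (T : ℕ → Fin 3 → ℕ) (n : ℕ) : SimpleGraph (Fin n) where
  Adj u v := u ≠ v ∧ ∃ s t, T u s = T v t
  symm := ⟨fun _ _ ⟨h, s, t, e⟩ => ⟨h.symm, t, s, e.symm⟩⟩
  loopless := ⟨fun _ h => h.1 rfl⟩

theorem threeEdgeColorable_induce_iff {V : Type*} (G : SimpleGraph V) (S : Set V) :
    ThreeEdgeColorable (G.induce S) ↔ ∃ f : Sym2 V → Kol, ∀ v ∈ S, ∀ u ∈ S, ∀ w ∈ S,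
      G.Adj v u → G.Adj v w → u ≠ w → f s(v, u) ≠ f s(v, w) := by
  constructor
  · rintro ⟨f, hf⟩
    have hinj : Function.Injective (Sym2.map (Subtype.val : S → V)) :=
      Sym2.map.injective Subtype.val_injective
    refine ⟨Function.extend (Sym2.map Subtype.val) f fun _ => ⟨(1, 0), by decide⟩, ?_⟩
    intro v hv u hu w hw hvu hvw huw
    have h1 := hinj.extend_apply f (fun _ => ⟨(1, 0), by decide⟩) s(⟨v, hv⟩, ⟨u, hu⟩)
    have h2 := hinj.extend_apply f (fun _ => ⟨(1, 0), by decide⟩) s(⟨v, hv⟩, ⟨w, hw⟩)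
    simp only [Sym2.map_mk] at h1 h2
    rw [h1, h2]
    exact hf _ hvu _ hvw (fun e => huw (congrArg Subtype.val (Sym2.congr_right.mp e)))
      ⟨⟨v, hv⟩, by simp, by simp⟩
  · rintro ⟨f, hf⟩
    refine ⟨fun e => f (e.map Subtype.val), ?_⟩
    rintro e₁ h₁ e₂ h₂ hne ⟨v, hv₁, hv₂⟩
    obtain ⟨u, rfl⟩ := hv₁
    obtain ⟨w, rfl⟩ := hv₂
    refine hf v v.2 u u.2 w w.2 h₁ h₂ fun h => hne ?_
    rw [Subtype.ext h]

section Closed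

variable {T : ℕ → Fin 3 → ℕ} {n m : ℕ}

theorem IsPole.isCubic (h : IsPole T n m 0) : IsCubic (poleGraph T n) := by
  intro v
  have hnb : ∀ s, ∃ w : Fin n, w ≠ v ∧ ∃ t, T w t = T v s := fun s => by
    obtain ⟨w, hw, hne, t, ht⟩ := h.inner v v.2 s (h.lt v v.2 s)
    exact ⟨⟨w, hw⟩, fun e => hne (congrArg Fin.val e), t, ht⟩
  choose nb hne t ht using hnb
  have hrange : (poleGraph T n).neighborSet v = Set.range nb := by
    ext w
    constructor
    · rintro ⟨hvw, s, r, e⟩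
      refine ⟨s, ?_⟩
      have := h.two w w.2 v v.2 (nb s) (nb s).2 r s (t s) e.symm (ht s).symm
      have h1 := hne s
      grind
    · rintro ⟨s, rfl⟩
      exact ⟨(hne s).symm, s, t s, (ht s).symm⟩
  have hinj : Function.Injective nb := fun s s' e => by
    have h1 := ht s'
    rw [← e] at h1
    rcases h.simple v v.2 (nb s) (nb s).2 s (t s) s' (t s') (ht s).symm h1.symm with h2 | h2
    · exact absurd (Fin.ext h2).symm (hne s)
    · exact h2
  rw [hrange, ← Set.image_univ, Set.ncard_image_of_injective _ hinj]
  simp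

theorem IsPole.connected (h : IsPole T n m 0) (hn : 0 < n) : (poleGraph T n).Connected := by
  have key : ∀ v (hv : v < n), (poleGraph T n).Reachable ⟨0, hn⟩ ⟨v, hv⟩ := by
    intro v
    induction v using Nat.strong_induction_on with
    | _ v ih =>
      intro hv
      rcases Nat.eq_zero_or_pos v with rfl | h0
      · rfl
      · obtain ⟨w, hw, s, t, e⟩ := h.conn v hv h0
        refine (ih w hw (hw.trans hv)).trans (SimpleGraph.Adj.reachable ⟨?_, t, s, e.symm⟩)
        simp [hw.ne]
  have : Nonempty (Fin n) := ⟨⟨0, hn⟩⟩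
  exact ⟨fun u v => (key u u.2).symm.trans (key v v.2)⟩

/-- The two colour sets have the same size. -/
theorem exists_equiv_kol : Nonempty (Fin 3 ≃ Kol) :=
  Fintype.card_eq.mp (by decide)

theorem IsPole.threeEdgeColorable_induce (h : IsPole T n m 0) {p q : Fin n} {c : ℕ → Fin 3}
    (hc : Colors T n [p, q] c) :
    ThreeEdgeColorable ((poleGraph T n).induce ({p, q}ᶜ : Set (Fin n))) := by
  classical
  obtain ⟨κ⟩ := exists_equiv_kol
  have hlab : ∀ e : Sym2 (Fin n), ∃ l, ∀ u v, e = s(u, v) → (poleGraph T n).Adj u v →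
      (∃ s, T u s = l) ∧ ∃ s, T v s = l := by
    intro e
    by_cases he : ∃ u v, e = s(u, v) ∧ (poleGraph T n).Adj u v
    · obtain ⟨u, v, rfl, -, s, t, hst⟩ := he
      refine ⟨T u s, fun u' v' e' _ => ?_⟩
      rcases Sym2.eq_iff.mp e' with ⟨rfl, rfl⟩ | ⟨rfl, rfl⟩
      · exact ⟨⟨s, rfl⟩, t, hst.symm⟩
      · exact ⟨⟨t, hst.symm⟩, s, rfl⟩
    · exact ⟨0, fun u v e' ha => (he ⟨u, v, e', ha⟩).elim⟩
  choose lab hlab using hlab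
  refine (threeEdgeColorable_induce_iff _ _).mpr ⟨fun e => κ (c (lab e)), ?_⟩
  intro v hv u hu w hw hvu hvw huw
  obtain ⟨⟨s, hs⟩, t, ht⟩ := hlab _ v u rfl hvu
  obtain ⟨⟨s', hs'⟩, t', ht'⟩ := hlab _ v w rfl hvw
  have hss : s ≠ s' := by
    rintro rfl
    have := h.two u u.2 v v.2 w w.2 t s t' (by rw [hs, ht]) (by rw [hs', ht'])
    have h1 := hvu.1
    have h2 := hvw.1
    grind
  dsimp only
  rw [← hs, ← hs']
  refine fun e => hc v v.2 ?_ s s' hss (κ.injective e)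
  simpa [Fin.val_inj] using hv

theorem IsPole.exists_colors (h : IsPole T n m 0) {p q : Fin n}
    (hf : ThreeEdgeColorable ((poleGraph T n).induce ({p, q}ᶜ : Set (Fin n)))) :
    ∃ c, Colors T n [p, q] c := by
  classical
  obtain ⟨κ⟩ := exists_equiv_kol
  obtain ⟨f, hf⟩ := (threeEdgeColorable_induce_iff _ _).mp hf
  have hnb : ∀ (v : Fin n) s, ∃ w : Fin n, w ≠ v ∧ ∃ t, T w t = T v s := fun v s => by
    obtain ⟨w, hw, hne, t, ht⟩ := h.inner v v.2 s (h.lt v v.2 s)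
    exact ⟨⟨w, hw⟩, fun e => hne (congrArg Fin.val e), t, ht⟩
  choose nb hne t ht using hnb
  have hadj : ∀ v s, (poleGraph T n).Adj v (nb v s) :=
    fun v s => ⟨(hne v s).symm, s, t v s, (ht v s).symm⟩
  have hinj : ∀ v s s', nb v s = nb v s' → s = s' := fun v s s' e => by
    have h1 := ht v s'
    rw [← e] at h1
    rcases h.simple v v.2 (nb v s) (nb v s).2 s (t v s) s' _ (ht v s).symm h1.symm with h2 | h2
    · exact absurd (Fin.ext h2).symm (hne v s)
    · exact h2
  have hg : ∀ v : Fin n, ∃ g : Fin 3 → Fin 3, Function.Injective g ∧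
      (v ∈ ({p, q}ᶜ : Set (Fin n)) → ∀ s, nb v s ∈ ({p, q}ᶜ : Set (Fin n)) →
        g s = κ.symm (f s(v, nb v s))) := fun v => by
    by_cases hv : v ∈ ({p, q}ᶜ : Set (Fin n))
    · obtain ⟨g, hg⟩ := Finset.exists_equiv_extend_of_card_eq
        (t := (Finset.univ : Finset (Fin 3))) (by simp)
        (s := Finset.univ.filter fun s => nb v s ∈ ({p, q}ᶜ : Set (Fin n)))
        (f := fun s => κ.symm (f s(v, nb v s))) (by simp) (by
          intro s hs s' hs' e
          by_contra hss
          refine hf v hv (nb v s) (by simpa using hs) (nb v s') (by simpa using hs') (hadj v s)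
            (hadj v s') (fun e' => hss (hinj v s s' e')) (κ.symm.injective e))
      refine ⟨fun s => g s, fun s s' e => g.injective (Subtype.ext e), fun _ s hs => ?_⟩
      exact hg s (by simpa using hs)
    · exact ⟨id, Function.injective_id, fun h => absurd h hv⟩
  choose g hginj hg using hg
  have hc : ∀ l, ∃ x, ∀ v ∈ ({p, q}ᶜ : Set (Fin n)), ∀ s, T v s = l → g v s = x := by
    intro l
    by_cases hl : ∃ v ∈ ({p, q}ᶜ : Set (Fin n)), ∃ s, T v s = l
    · obtain ⟨v, hv, s, rfl⟩ := hl
      refine ⟨g v s, fun v' hv' s' e => ?_⟩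
      by_cases hvv : v' = v
      · subst hvv
        rw [h.inj v' v'.2 s' s e]
      · have h1 : nb v s = v' := by
          have := h.two v' v'.2 v v.2 _ (nb v s).2 s' s (t v s) e (ht v s).symm
          have := hne v s
          grind
        have h2 : nb v' s' = v := by
          have := h.two v v.2 v' v'.2 _ (nb v' s').2 s s' (t v' s') e.symm (ht v' s').symm
          have := hne v' s'
          grind
        rw [hg v hv s (h1 ▸ hv'), hg v' hv' s' (h2 ▸ hv), h1, h2, Sym2.eq_swap]
    · exact ⟨0, fun v hv s e => (hl ⟨v, hv, s, e⟩).elim⟩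
  choose c hc using hc
  refine ⟨c, fun v hv hvS s s' hss e => hss ?_⟩
  have hv' : (⟨v, hv⟩ : Fin n) ∈ ({p, q}ᶜ : Set (Fin n)) := by
    simpa [Fin.ext_iff] using hvS
  rw [← hc _ _ hv' s rfl, ← hc _ _ hv' s' rfl] at e
  exact hginj _ e

theorem IsPole.isSnark_strictlyCritical (h : IsPole T n m 0)
    (hcrit : ∀ u < n, ∀ v < n, u ≠ v → ∀ s t, T u s = T v t → ∃ c, Colors T n [u, v] c)
    (hstuck : ∃ p < n, ∃ q < n, p ≠ q ∧ ∀ c, ¬ Colors T n [p, q] c) :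
    IsSnark (poleGraph T n) ∧ StrictlyCritical (poleGraph T n) := by
  obtain ⟨p, hp, q, hq, hpq, hno⟩ := hstuck
  have hpq' : ¬ ThreeEdgeColorable
      ((poleGraph T n).induce ({⟨p, hp⟩, ⟨q, hq⟩}ᶜ : Set (Fin n))) := fun hf => by
    obtain ⟨c, hc⟩ := h.exists_colors hf
    exact hno c hc
  refine ⟨⟨h.connected (by omega), h.isCubic, fun ⟨f, hf⟩ => hpq' ?_⟩, ?_, fun hb => hpq' ?_⟩
  · refine (threeEdgeColorable_induce_iff _ _).mpr ⟨f, fun v _ u _ w _ hvu hvw huw => ?_⟩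
    exact hf _ hvu _ hvw (fun e => huw (Sym2.congr_right.mp e)) ⟨v, by simp, by simp⟩
  · rintro u v ⟨huv, s, t, e⟩
    obtain ⟨c, hc⟩ := hcrit u u.2 v v.2 (fun e => huv (Fin.ext e)) s t e
    exact h.threeEdgeColorable_induce hc
  · exact hb _ _ fun e => hpq (congrArg Fin.val e)

end Closed
/-! ### Attaching a block to a pole with four dangling edges -/

/-- A block on `b` vertices whose labels `0, 1, 2, 3` are incoming edges, whose labels
`4, …, j - 1` are inner edges and whose labels `j, …, j + k - 1` are outgoing edges. -/
structure IsBlock (B : ℕ → Fin 3 → ℕ) (b j k : ℕ) : Prop where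
  four_le : 4 ≤ j
  lt : ∀ i < b, ∀ s, B i s < j + k
  inj : ∀ i < b, ∀ s t, B i s = B i t → s = t
  two : ∀ u < b, ∀ v < b, ∀ w < b, ∀ s t r, B u s = B v t → B v t = B w r →
    u = v ∨ v = w ∨ u = w
  inner : ∀ v < b, ∀ s, 4 ≤ B v s → B v s < j → ∃ w < b, w ≠ v ∧ ∃ t, B w t = B v s
  in_exists : ∀ l < 4, ∃ v < b, ∃ s, B v s = l
  in_unique : ∀ u < b, ∀ v < b, ∀ s t, B u s < 4 → B u s = B v t → u = v
  in_once : ∀ v < b, ∀ s t, B v s < 4 → B v t < 4 → s = t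
  outer_exists : ∀ i < k, ∃ v < b, ∃ s, B v s = j + i
  outer_unique : ∀ u < b, ∀ v < b, ∀ s t, j ≤ B u s → B u s = B v t → u = v
  simple : ∀ u < b, ∀ v < b, ∀ s t s' t', B u s = B v t → B u s' = B v t' → u = v ∨ s = s'
  conn : ∀ v < b, (∃ s, B v s < 4) ∨ ∃ w < v, ∃ s t, B v s = B w t

/-- Attach the block `B` to the dangling edges `m, …, m + 3` of the first `n` vertices of `T`. -/
def attach (T : ℕ → Fin 3 → ℕ) (n m : ℕ) (B : ℕ → Fin 3 → ℕ) (v : ℕ) (s : Fin 3) : ℕ :=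
  if v < n then T v s else m + B (v - n) s

section Glue

variable {T B : ℕ → Fin 3 → ℕ} {n m b j k : ℕ}

theorem attach_of_lt {v : ℕ} (hv : v < n) (s : Fin 3) : attach T n m B v s = T v s :=
  if_pos hv

theorem attach_add (i : ℕ) (s : Fin 3) : attach T n m B (n + i) s = m + B i s := by
  simp [attach]

theorem lt_or_exists_add {v : ℕ} (hv : v < n + b) : v < n ∨ ∃ i < b, v = n + i := by
  rcases lt_or_ge v n with h | h
  · exact .inl h
  · exact .inr ⟨v - n, by omega, by omega⟩

theorem IsPole.glue (h : IsPole T n m 4) (hB : IsBlock B b j k) :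
    IsPole (attach T n m B) (n + b) (m + j) k := by
  have hj := hB.four_le
  constructor
  · intro v hv s
    rcases lt_or_exists_add hv with hv | ⟨i, hi, rfl⟩
    · rw [attach_of_lt hv]
      have := h.lt v hv s
      omega
    · rw [attach_add]
      have := hB.lt i hi s
      omega
  · intro v hv s t e
    rcases lt_or_exists_add hv with hv | ⟨i, hi, rfl⟩
    · rw [attach_of_lt hv, attach_of_lt hv] at e
      exact h.inj v hv s t e
    · rw [attach_add, attach_add] at e
      exact hB.inj i hi s t (by omega)
  · intro u hu v hv w hw s t r e e'
    rcases lt_or_exists_add hu with hu | ⟨i, hi, rfl⟩ <;>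
    rcases lt_or_exists_add hv with hv | ⟨i', hi', rfl⟩ <;>
    rcases lt_or_exists_add hw with hw | ⟨i'', hi'', rfl⟩ <;>
    simp only [attach_of_lt, attach_add, *] at e e'
    · exact h.two u hu v hv w hw s t r e e'
    · exact .inl (h.outer_unique u hu v hv s t (by omega) e)
    · exact .inr (.inr (h.outer_unique u hu w hw s r (by omega) (by omega)))
    · have := h.lt u hu s
      exact .inr (.inl (by rw [hB.in_unique i' hi' i'' hi'' t r (by omega) (by omega)]))
    · exact .inr (.inl (h.outer_unique v hv w hw t r (by omega) e'))
    · have := h.lt v hv t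
      exact .inr (.inr (by rw [hB.in_unique i hi i'' hi'' s r (by omega) (by omega)]))
    · have := h.lt w hw r
      exact .inl (by rw [hB.in_unique i hi i' hi' s t (by omega) (by omega)])
    · have := hB.two i hi i' hi' i'' hi'' s t r (by omega) (by omega)
      omega
  · intro v hv s hs
    rcases lt_or_exists_add hv with hv | ⟨i, hi, rfl⟩
    · rw [attach_of_lt hv] at hs ⊢
      by_cases hm : T v s < m
      · obtain ⟨w, hw, hne, t, ht⟩ := h.inner v hv s hm
        exact ⟨w, by omega, hne, t, by rw [attach_of_lt hw, ht]⟩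
      · have := h.lt v hv s
        obtain ⟨i, hi, t, ht⟩ := hB.in_exists (T v s - m) (by omega)
        exact ⟨n + i, by omega, by omega, t, by rw [attach_add]; omega⟩
    · rw [attach_add] at hs ⊢
      by_cases hm : B i s < 4
      · obtain ⟨w, hw, t, ht⟩ := h.outer_exists _ hm
        exact ⟨w, by omega, by omega, t, by rw [attach_of_lt hw, ht]⟩
      · obtain ⟨w, hw, hne, t, ht⟩ := hB.inner i hi s (by omega) (by omega)
        exact ⟨n + w, by omega, by omega, t, by rw [attach_add, ht]⟩
  · intro i hi
    obtain ⟨v, hv, s, hs⟩ := hB.outer_exists i hi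
    exact ⟨n + v, by omega, s, by rw [attach_add]; omega⟩
  · intro u hu v hv s t hle e
    rcases lt_or_exists_add hu with hu | ⟨i, hi, rfl⟩ <;>
    rcases lt_or_exists_add hv with hv | ⟨i', hi', rfl⟩ <;>
    simp only [attach_of_lt, attach_add, *] at e hle
    · have := h.lt v hv t
      omega
    · have := h.lt u hu s
      omega
    · have := h.lt v hv t
      omega
    · rw [hB.outer_unique i hi i' hi' s t (by omega) (by omega)]
  · intro u hu v hv s t s' t' e e'
    rcases lt_or_exists_add hu with hu | ⟨i, hi, rfl⟩ <;>
    rcases lt_or_exists_add hv with hv | ⟨i', hi', rfl⟩ <;>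
    simp only [attach_of_lt, attach_add, *] at e e'
    · exact h.simple u hu v hv s t s' t' e e'
    · have := h.lt u hu s
      have := h.lt u hu s'
      have := hB.in_once i' hi' t t' (by omega) (by omega)
      subst this
      exact .inr (h.inj u hu s s' (by omega))
    · have := h.lt v hv t
      have := h.lt v hv t'
      exact .inr (hB.in_once i hi s s' (by omega) (by omega))
    · have := hB.simple i hi i' hi' s t s' t' (by omega) (by omega)
      omega
  · intro v hv h0
    rcases lt_or_exists_add hv with hv | ⟨i, hi, rfl⟩
    · obtain ⟨w, hw, s, t, e⟩ := h.conn v hv h0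
      exact ⟨w, hw, s, t, by rw [attach_of_lt hv, attach_of_lt (hw.trans hv), e]⟩
    · rcases hB.conn i hi with ⟨s, hs⟩ | ⟨w, hw, s, t, e⟩
      · obtain ⟨w, hw, t, ht⟩ := h.outer_exists _ hs
        exact ⟨w, by omega, s, t, by rw [attach_of_lt hw, attach_add, ht]⟩
      · exact ⟨n + w, by omega, s, t, by rw [attach_add, attach_add, e]⟩

theorem Colors.glue {S S₁ S₂ : List ℕ} {c d : ℕ → Fin 3} (h : IsPole T n m 4)
    (hc : Colors T n S₁ c) (hd : Colors B b S₂ d)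
    (h₁ : ∀ v < n, v ∈ S₁ → v ∈ S) (h₂ : ∀ i < b, i ∈ S₂ → n + i ∈ S)
    (hcd : ∀ i < 4, c (m + i) = d i) :
    ∃ c', Colors (attach T n m B) (n + b) S c' ∧ ∀ i, c' (m + i) = d i := by
  have h1 : ∀ l < m + 4, (if l < m then c l else d (l - m)) = c l := fun l hl => by
    split_ifs with hm
    · rfl
    · rw [← hcd _ (by omega)]
      congr 1
      omega
  refine ⟨fun l => if l < m then c l else d (l - m), fun v hv hvS s t hst => ?_, fun i => ?_⟩
  · rcases lt_or_exists_add hv with hv | ⟨i, hi, rfl⟩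
    · simp only [attach_of_lt hv, h1 _ (h.lt v hv _)]
      exact hc v hv (fun hv' => hvS (h₁ v hv hv')) s t hst
    · simpa [attach_add] using hd i hi (fun hi' => hvS (h₂ i hi hi')) s t hst
  · simp

theorem Colors.left {S : List ℕ} {c : ℕ → Fin 3} (hc : Colors (attach T n m B) (n + b) S c) :
    Colors T n S c := fun v hv hvS s t hst => by
  simpa only [attach_of_lt hv] using hc v (by omega) hvS s t hst

theorem Colors.right {p q : ℕ} {c : ℕ → Fin 3}
    (hc : Colors (attach T n m B) (n + b) [p, q] c) (hp : p < n) (hq : q < n) :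
    Colors B b [] fun l => c (m + l) := fun i hi _ s t hst => by
  have := hc (n + i) (by omega) (by simp; omega) s t hst
  simpa only [attach_add] using this

theorem Colors.swap {u v : ℕ} {c : ℕ → Fin 3} (hc : Colors T n [u, v] c) :
    Colors T n [v, u] c := fun w hw hwS => hc w hw (by simp_all)

end Glue
/-! ### The inductive step -/

/-- The first two of the four values are distinct and reappear, in some order, as the last two. -/
def Passing (a : ℕ → Fin 3) : Prop :=
  a 0 ≠ a 1 ∧ (a 2 = a 0 ∧ a 3 = a 1 ∨ a 2 = a 1 ∧ a 3 = a 0)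

/-- The first two of the four values agree, and so do the last two. -/
def Paired (a : ℕ → Fin 3) : Prop :=
  a 0 = a 1 ∧ a 2 = a 3

instance (a : ℕ → Fin 3) : Decidable (Passing a) :=
  inferInstanceAs (Decidable (_ ∧ _))

instance (a : ℕ → Fin 3) : Decidable (Paired a) :=
  inferInstanceAs (Decidable (_ ∧ _))

/-- The colours required on the four dangling edges when the end of the `i`-th one is deleted. -/
def pendantPattern (i l : ℕ) : Fin 3 :=
  (([[0, 0, 1, 2], [0, 0, 1, 2], [0, 1, 0, 2], [0, 1, 2, 0]] : List (List (Fin 3))).getD i []).getD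
    l 0

/-- The edges of the pole can be deleted, in the presence of paired dangling edges, but some
pair of vertices cannot. -/
structure IsStrict (T : ℕ → Fin 3 → ℕ) (n m : ℕ) : Prop where
  critical : ∀ u < n, ∀ v < n, u ≠ v → ∀ s t, T u s = T v t →
    ∃ c, Colors T n [u, v] c ∧ Paired fun i => c (m + i)
  stuck : ∃ p < n, ∃ q < n, p ≠ q ∧ ∀ c, Colors T n [p, q] c → ¬ Paired fun i => c (m + i)

/-- The pole has all colourings needed for attaching a block. -/
structure IsFlexible (T : ℕ → Fin 3 → ℕ) (n m : ℕ) : Prop where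
  passing : ∀ a, Passing a → ∃ c, Colors T n [] c ∧ ∀ i < 4, c (m + i) = a i
  pendant : ∀ i < 4, ∃ v < n, (∃ s, T v s = m + i) ∧
    ∃ c, Colors T n [v] c ∧ ∀ l < 4, c (m + l) = pendantPattern i l

/-- The block transmits strictness from its incoming edges to its outgoing edges. -/
structure PreservesStrict (B : ℕ → Fin 3 → ℕ) (b j : ℕ) : Prop where
  paired : ∀ a, Paired a →
    ∃ d, Colors B b [] d ∧ (∀ i < 4, d i = a i) ∧ Paired fun i => d (j + i)
  critical : ∀ u < b, ∀ v < b, u ≠ v → ∀ s t, B u s = B v t →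
    ∃ d, Colors B b [u, v] d ∧ Passing d ∧ Paired fun i => d (j + i)
  pendant : ∀ l < 4, ∃ v < b, (∃ s, B v s = l) ∧
    ∃ d, Colors B b [v] d ∧ (∀ i < 4, d i = pendantPattern l i) ∧ Paired fun i => d (j + i)
  reflect : ∀ d, Colors B b [] d → Paired (fun i => d (j + i)) → Paired d

/-- The block transmits flexibility from its incoming edges to its outgoing edges. -/
structure PreservesFlexible (B : ℕ → Fin 3 → ℕ) (b j : ℕ) : Prop where
  passing : ∀ a, Passing a → ∃ d, Colors B b [] d ∧ Passing d ∧ ∀ i < 4, d (j + i) = a i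
  pendant : ∀ i < 4, ∃ v < b, (∃ s, B v s = j + i) ∧
    ∃ d, Colors B b [v] d ∧ Passing d ∧ ∀ l < 4, d (j + l) = pendantPattern i l

section Step

variable {T B : ℕ → Fin 3 → ℕ} {n m b j k : ℕ}

theorem IsStrict.glue (hs : IsStrict T n m) (h : IsPole T n m 4) (hf : IsFlexible T n m)
    (hB : IsBlock B b j k) (hp : PreservesStrict B b j) :
    IsStrict (attach T n m B) (n + b) (m + j) := by
  constructor
  · have cross : ∀ u < n, ∀ i < b, ∀ s t, T u s = m + B i t →
        ∃ c, Colors (attach T n m B) (n + b) [u, n + i] c ∧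
          Paired fun l => c (m + j + l) := by
      intro u hu i hi s t e
      have hl : B i t < 4 := by
        have := h.lt u hu s
        omega
      obtain ⟨u', hu', ⟨s', e'⟩, c, hc, hca⟩ := hf.pendant _ hl
      obtain rfl := h.outer_unique u hu u' hu' s s' (by omega) (by omega)
      obtain ⟨i', hi', ⟨t', e''⟩, d, hd, hda, hdp⟩ := hp.pendant _ hl
      obtain rfl := hB.in_unique i hi i' hi' t t' hl e''.symm
      obtain ⟨c', hc', h'⟩ := Colors.glue (S := [u, n + i]) h hc hd (by simp_all) (by simp_all)
        fun l hl => by rw [hca l hl, hda l hl]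
      exact ⟨c', hc', by simpa only [add_assoc, h'] using hdp⟩
    intro u hu v hv huv s t e
    rcases lt_or_exists_add hu with hu | ⟨i, hi, rfl⟩ <;>
    rcases lt_or_exists_add hv with hv | ⟨i', hi', rfl⟩ <;>
    simp only [attach_of_lt, attach_add, *] at e
    · obtain ⟨c, hc, hca⟩ := hs.critical u hu v hv huv s t e
      obtain ⟨d, hd, hda, hdp⟩ := hp.paired _ hca
      obtain ⟨c', hc', h'⟩ := Colors.glue (S := [u, v]) h hc hd (by simp) (by simp)
        fun l hl => (hda l hl).symm
      exact ⟨c', hc', by simpa only [add_assoc, h'] using hdp⟩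
    · exact cross u hu i' hi' s t e
    · obtain ⟨c, hc, hca⟩ := cross v hv i hi t s e.symm
      exact ⟨c, hc.swap, hca⟩
    · obtain ⟨d, hd, hda, hdp⟩ := hp.critical i hi i' hi' (by omega) s t (by omega)
      obtain ⟨c, hc, hca⟩ := hf.passing d hda
      obtain ⟨c', hc', h'⟩ := Colors.glue (S := [n + i, n + i']) h hc hd (by simp) (by simp) hca
      exact ⟨c', hc', by simpa only [add_assoc, h'] using hdp⟩
  · obtain ⟨p, hp', q, hq, hpq, hno⟩ := hs.stuck
    refine ⟨p, by omega, q, by omega, hpq, fun c hc hca => hno c hc.left ?_⟩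
    exact hp.reflect _ (hc.right hp' hq) (by simpa only [add_assoc] using hca)

theorem IsFlexible.glue (hf : IsFlexible T n m) (h : IsPole T n m 4)
    (hp : PreservesFlexible B b j) : IsFlexible (attach T n m B) (n + b) (m + j) := by
  constructor
  · intro a ha
    obtain ⟨d, hd, hdp, hda⟩ := hp.passing a ha
    obtain ⟨c, hc, hca⟩ := hf.passing d hdp
    obtain ⟨c', hc', h'⟩ := Colors.glue (S := []) h hc hd (by simp) (by simp) hca
    exact ⟨c', hc', by simpa only [add_assoc, h'] using hda⟩
  · intro i hi
    obtain ⟨v, hv, ⟨s, hs⟩, d, hd, hdp, hda⟩ := hp.pendant i hi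
    obtain ⟨c, hc, hca⟩ := hf.passing d hdp
    obtain ⟨c', hc', h'⟩ := Colors.glue (S := [n + v]) h hc hd (by simp) (by simp) hca
    exact ⟨n + v, by omega, ⟨s, by rw [attach_add, hs, add_assoc]⟩, c', hc',
      by simpa only [add_assoc, h'] using hda⟩

theorem IsPole.isSnark_strictlyCritical_of_isStrict (h : IsPole T n m 0) (hs : IsStrict T n m) :
    IsSnark (poleGraph T n) ∧ StrictlyCritical (poleGraph T n) := by
  refine h.isSnark_strictlyCritical (fun u hu v hv huv s t e => ?_) ?_
  · obtain ⟨c, hc, -⟩ := hs.critical u hu v hv huv s t e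
    exact ⟨c, hc⟩
  · obtain ⟨p, hp, q, hq, hpq, hno⟩ := hs.stuck
    refine ⟨p, hp, q, hq, hpq, fun c hc =>
      hno (fun l => if l < m then c l else 0) (fun v hv hvS s t hst => ?_) (by simp [Paired])⟩
    have h1 := h.lt v hv s
    have h2 := h.lt v hv t
    simp only [add_zero] at h1 h2
    simpa only [h1, h2, if_true] using hc v hv hvS s t hst

/-- Attach `k` copies of the block `B` with `b` vertices and inner labels below `j`. -/
def chain (T : ℕ → Fin 3 → ℕ) (n m : ℕ) (B : ℕ → Fin 3 → ℕ) (b j : ℕ) : ℕ → ℕ → Fin 3 → ℕ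
  | 0 => T
  | k + 1 => attach (chain T n m B b j k) (n + b * k) (m + j * k) B

theorem chain_spec (h : IsPole T n m 4) (hs : IsStrict T n m) (hf : IsFlexible T n m)
    (hB : IsBlock B b j 4) (hp : PreservesStrict B b j) (hp' : PreservesFlexible B b j) (k : ℕ) :
    IsPole (chain T n m B b j k) (n + b * k) (m + j * k) 4 ∧
      IsStrict (chain T n m B b j k) (n + b * k) (m + j * k) ∧
      IsFlexible (chain T n m B b j k) (n + b * k) (m + j * k) := by
  induction k with
  | zero => exact ⟨h, hs, hf⟩
  | succ k ih =>
    obtain ⟨h, hs, hf⟩ := ih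
    simp only [Nat.mul_succ, ← add_assoc]
    exact ⟨h.glue hB, hs.glue h hf hB hp, hf.glue h hp'⟩

end Step
/-! ### Decision procedures -/

/-- The labels given by an explicit table. -/
def slots (L : List (List ℕ)) (v : ℕ) (s : Fin 3) : ℕ :=
  (L.getD v []).getD s 0

/-- The colouring of the labels encoded by the ternary digits of `N`. -/
def digit (N l : ℕ) : Fin 3 :=
  Fin.ofNat 3 (N / 3 ^ l)

/-- The first entry of the `l`-th pair of an explicit table. -/
def endOne (E : List (ℕ × ℕ)) (l : ℕ) : ℕ :=
  (E.getD l (0, 0)).1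

/-- The second entry of the `l`-th pair of an explicit table. -/
def endTwo (E : List (ℕ × ℕ)) (l : ℕ) : ℕ :=
  (E.getD l (0, 0)).2

/-- The functions `E₁` and `E₂` list the two ends of each label below `m`, and twice the end of
each label `m, …, m + k - 1`. -/
structure HasEnds (T : ℕ → Fin 3 → ℕ) (n m k : ℕ) (E₁ E₂ : ℕ → ℕ) : Prop where
  lt : ∀ v < n, ∀ s, T v s < m + k
  inj : ∀ v < n, ∀ s t, T v s = T v t → s = t
  eq_or : ∀ v < n, ∀ s, v = E₁ (T v s) ∨ v = E₂ (T v s)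
  inner : ∀ l < m, E₁ l < E₂ l ∧ E₂ l < n ∧ (∃ s, T (E₁ l) s = l) ∧ ∃ s, T (E₂ l) s = l
  outer : ∀ i < k, E₁ (m + i) = E₂ (m + i) ∧ E₁ (m + i) < n ∧ ∃ s, T (E₁ (m + i)) s = m + i
  simple : ∀ l < m, ∀ l' < l, ¬ (E₁ l = E₁ l' ∧ E₂ l = E₂ l')
  conn : ∀ v < n, 0 < v → ∃ s, E₁ (T v s) < v

section Decide

variable {T : ℕ → Fin 3 → ℕ} {n m k : ℕ} {E₁ E₂ : ℕ → ℕ}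

theorem HasEnds.outer_eq (h : HasEnds T n m k E₁ E₂) {v : ℕ} (hv : v < n) {s : Fin 3}
    (hs : m ≤ T v s) : E₁ (T v s) = E₂ (T v s) := by
  have h1 := h.lt v hv s
  have h2 := (h.outer (T v s - m) (by omega)).1
  rwa [Nat.add_sub_cancel' hs] at h2

theorem HasEnds.isPole (h : HasEnds T n m k E₁ E₂) : IsPole T n m k := by
  refine ⟨h.lt, h.inj, ?_, ?_, ?_, ?_, ?_, ?_⟩
  · intro u hu v hv w hw s t r e e'
    have h1 := h.eq_or u hu s
    have h2 := h.eq_or v hv t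
    have h3 := h.eq_or w hw r
    rw [e] at h1
    rw [← e'] at h3
    omega
  · intro v hv s hs
    obtain ⟨h1, h2, h3, h4⟩ := h.inner _ hs
    rcases h.eq_or v hv s with e | e
    · exact ⟨_, h2, by omega, h4⟩
    · exact ⟨_, h1.trans h2, by omega, h3⟩
  · intro i hi
    exact ⟨_, (h.outer i hi).2⟩
  · intro u hu v hv s t hm e
    have h1 := h.eq_or u hu s
    have h2 := h.eq_or v hv t
    have h3 := h.outer_eq hu hm
    rw [← e] at h2
    omega
  · intro u hu v hv s t s' t' e e'
    by_cases huv : u = v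
    · exact .inl huv
    have h1 := h.eq_or u hu s
    have h2 := h.eq_or v hv t
    have h1' := h.eq_or u hu s'
    have h2' := h.eq_or v hv t'
    rw [← e] at h2
    rw [← e'] at h2'
    have hm : T u s < m := by
      by_contra! hm
      have := h.outer_eq hu hm
      omega
    have hm' : T u s' < m := by
      by_contra! hm'
      have := h.outer_eq hu hm'
      omega
    have h3 := (h.inner _ hm).1
    have h3' := (h.inner _ hm').1
    refine .inr (h.inj u hu s s' ?_)
    rcases lt_trichotomy (T u s) (T u s') with hlt | heq | hlt
    · exact absurd (by omega) (h.simple _ hm' _ hlt)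
    · exact heq
    · exact absurd (by omega) (h.simple _ hm _ hlt)
  · intro v hv h0
    obtain ⟨s, hs⟩ := h.conn v hv h0
    by_cases hm : T v s < m
    · obtain ⟨t, ht⟩ := (h.inner _ hm).2.2.1
      exact ⟨_, hs, s, t, ht.symm⟩
    · have h1 := h.eq_or v hv s
      have h2 := h.outer_eq hv (not_lt.mp hm)
      omega

theorem HasEnds.exists_colors (h : HasEnds T n m k E₁ E₂)
    (hc : ∀ l < m, ∃ c, Colors T n [E₁ l, E₂ l] c ∧ Paired fun i => c (m + i)) :
    ∀ u < n, ∀ v < n, u ≠ v → ∀ s t, T u s = T v t →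
      ∃ c, Colors T n [u, v] c ∧ Paired fun i => c (m + i) := by
  intro u hu v hv huv s t e
  have h1 := h.eq_or u hu s
  have h2 := h.eq_or v hv t
  rw [← e] at h2
  have hm : T u s < m := by
    by_contra! hm
    have := h.outer_eq hu hm
    omega
  obtain ⟨c, hc, hca⟩ := hc _ hm
  refine ⟨c, ?_, hca⟩
  have h3 := (h.inner _ hm).1
  rcases h1 with h1 | h1
  · rwa [← h1, ← show v = E₂ (T u s) by omega] at hc
  · rw [← h1, ← show v = E₁ (T u s) by omega] at hc
    exact hc.swap

/-- The six ways of colouring three edges with distinct colours. -/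
def perms : List (ℕ × ℕ × ℕ) :=
  [(0, 1, 2), (0, 2, 1), (1, 0, 2), (1, 2, 0), (2, 0, 1), (2, 1, 0)]

/-- The bits of the colours other than `a` of the label `x`. -/
def forbidden (x a : ℕ) : ℕ :=
  2 ^ (3 * x + (a + 1) % 3) ||| 2 ^ (3 * x + (a + 2) % 3)

/-- Whether the partial colouring `M` of the labels, whose bit `3 * l + a` records that the label
`l` has colour `a`, extends to a colouring that is proper at the vertices in the list, where `f`
is a map identifying some of the labels. -/
def search (T : ℕ → Fin 3 → ℕ) (f : ℕ → ℕ) : List ℕ → ℕ → Bool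
  | [], _ => true
  | v :: L, M => perms.any fun p =>
      Nat.beq (M &&& (forbidden (f (T v 0)) p.1 ||| forbidden (f (T v 1)) p.2.1 |||
        forbidden (f (T v 2)) p.2.2)) 0 &&
      search T f L (M ||| (2 ^ (3 * f (T v 0) + p.1) ||| 2 ^ (3 * f (T v 1) + p.2.1) |||
        2 ^ (3 * f (T v 2) + p.2.2)))

theorem search_eq_true {f : ℕ → ℕ} {c : ℕ → Fin 3} (hf : ∀ l, c (f l) = c l) (L : List ℕ)
    (hL : ∀ v ∈ L, ∀ s t, s ≠ t → c (T v s) ≠ c (T v t)) (M : ℕ)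
    (hM : ∀ i, M.testBit i = true → (c (i / 3)).val = i % 3) : search T f L M = true := by
  induction L generalizing M with
  | nil => rfl
  | cons v L ih =>
    have hmem : ∀ a b d : Fin 3, a ≠ b → a ≠ d → b ≠ d → (a.val, b.val, d.val) ∈ perms := by
      decide
    have hv := hL v (by simp)
    have hset : ∀ l i, 2 ^ (3 * f l + (c l).val) = 2 ^ i → (c (i / 3)).val = i % 3 := by
      intro l i e
      obtain rfl := Nat.pow_right_injective le_rfl e
      have := (c l).isLt
      rw [show (3 * f l + (c l).val) / 3 = f l by omega, hf]
      omega
    have hforb : ∀ l i, (forbidden (f l) (c l)).testBit i = true → (c (i / 3)).val ≠ i % 3 := by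
      intro l i e
      have := (c l).isLt
      simp only [forbidden, Nat.testBit_or, Nat.testBit_two_pow, Bool.or_eq_true,
        decide_eq_true_eq] at e
      rw [show i / 3 = f l by omega, hf]
      omega
    simp only [search, List.any_eq_true, Bool.and_eq_true]
    refine ⟨_, hmem (c (T v 0)) (c (T v 1)) (c (T v 2)) (hv 0 1 (by decide))
      (hv 0 2 (by decide)) (hv 1 2 (by decide)), ?_, ih (fun w hw => hL w (by simp [hw])) _ ?_⟩
    · rw [Nat.beq_eq]
      refine Nat.eq_of_testBit_eq fun i => ?_
      rw [Nat.zero_testBit, Bool.eq_false_iff]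
      simp only [Nat.testBit_and, Nat.testBit_or, Bool.and_eq_true, Bool.or_eq_true, ne_eq]
      rintro ⟨h1, (h2 | h2) | h2⟩ <;> exact hforb _ _ h2 (hM i h1)
    · intro i
      simp only [Nat.testBit_or, Nat.testBit_two_pow, Bool.or_eq_true, decide_eq_true_eq]
      rintro (h1 | (h1 | h1) | h1)
      · exact hM i h1
      all_goals exact hset _ _ (by rw [h1])

/-- Identify the label `j + 1` with `j`, and `j + 3` with `j + 2`. -/
def fold (j l : ℕ) : ℕ :=
  if l = j + 1 then j else if l = j + 3 then j + 2 else l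

theorem Paired.apply_fold {c : ℕ → Fin 3} {j : ℕ} (h : Paired fun i => c (j + i)) (l : ℕ) :
    c (fold j l) = c l := by
  simp only [fold]
  split_ifs with h1 h2
  · rw [h1]
    exact h.1
  · rw [h2]
    exact h.2
  · rfl

theorem not_paired_of_search {p q : ℕ}
    (hs : search T (fold m) ((List.range n).filter fun v => v ≠ p ∧ v ≠ q) 0 = false)
    (c : ℕ → Fin 3) (hc : Colors T n [p, q] c) : ¬ Paired fun i => c (m + i) := fun h => by
  have := search_eq_true h.apply_fold ((List.range n).filter fun v => v ≠ p ∧ v ≠ q)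
    (fun v hv => hc v (by simp_all) (by simp_all)) 0 (by simp)
  exact Bool.false_ne_true (hs.symm.trans this)

theorem paired_of_search {j : ℕ}
    (hs : ∀ i : Fin 2, ∀ a b : Fin 3, a ≠ b → search T (fold j) (List.range n)
      (2 ^ (6 * i.val + a.val) ||| 2 ^ (6 * i.val + 3 + b.val)) = false)
    (c : ℕ → Fin 3) (hc : Colors T n [] c) (h : Paired fun i => c (j + i)) : Paired c := by
  have key : ∀ i : Fin 2, c (2 * i.val) = c (2 * i.val + 1) := fun i => by
    by_contra hne
    have := search_eq_true h.apply_fold (List.range n) (fun v hv => hc v (by simp_all) (by simp))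
      (2 ^ (6 * i.val + (c (2 * i.val)).val) ||| 2 ^ (6 * i.val + 3 + (c (2 * i.val + 1)).val)) (by
        intro x
        have h1 := (c (2 * i.val)).isLt
        have h2 := (c (2 * i.val + 1)).isLt
        simp only [Nat.testBit_or, Nat.testBit_two_pow, Bool.or_eq_true, decide_eq_true_eq]
        rintro (rfl | rfl)
        · rw [show (6 * i.val + (c (2 * i.val)).val) / 3 = 2 * i.val by omega]
          omega
        · rw [show (6 * i.val + 3 + (c (2 * i.val + 1)).val) / 3 = 2 * i.val + 1 by omega]
          omega)
    exact Bool.false_ne_true ((hs i _ _ hne).symm.trans this)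
  exact ⟨key 0, key 1⟩

end Decide
/-! ### Certificates -/

/-- The four values `x, y, z, w`. -/
def quad (x y z w : Fin 3) (l : ℕ) : Fin 3 :=
  [x, y, z, w].getD l 0

theorem eq_quad (a : ℕ → Fin 3) : ∀ i < 4, a i = quad (a 0) (a 1) (a 2) (a 3) i := fun i hi => by
  interval_cases i <;> rfl

theorem Passing.exists_quad {a : ℕ → Fin 3} (h : Passing a) : ∃ x y, x ≠ y ∧
    ((∀ i < 4, a i = quad x y x y i) ∨ ∀ i < 4, a i = quad x y y x i) := by
  have ha := eq_quad a
  refine ⟨_, _, h.1, ?_⟩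
  rcases h.2 with ⟨h2, h3⟩ | ⟨h2, h3⟩ <;> rw [h2, h3] at ha
  · exact .inl ha
  · exact .inr ha

theorem Paired.exists_quad {a : ℕ → Fin 3} (h : Paired a) :
    ∃ x y, ∀ i < 4, a i = quad x x y y i := by
  have ha := eq_quad a
  rw [← h.1, ← h.2] at ha
  exact ⟨_, _, ha⟩

section Certificates

variable {T B : ℕ → Fin 3 → ℕ} {n m b j : ℕ}

theorem IsFlexible.of_certificates (L : List ℕ)
    (h₁ : ∀ x y : Fin 3, x ≠ y →
      (∃ N ∈ L, Colors T n [] (digit N) ∧ ∀ i < 4, digit N (m + i) = quad x y x y i) ∧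
      ∃ N ∈ L, Colors T n [] (digit N) ∧ ∀ i < 4, digit N (m + i) = quad x y y x i)
    (h₂ : ∀ i < 4, ∃ v < n, (∃ s, T v s = m + i) ∧
      ∃ N ∈ L, Colors T n [v] (digit N) ∧ ∀ l < 4, digit N (m + l) = pendantPattern i l) :
    IsFlexible T n m := by
  constructor
  · intro a ha
    obtain ⟨x, y, hxy, h | h⟩ := ha.exists_quad
    · obtain ⟨N, -, hN, hNa⟩ := (h₁ x y hxy).1
      exact ⟨_, hN, fun i hi => by rw [hNa i hi, h i hi]⟩
    · obtain ⟨N, -, hN, hNa⟩ := (h₁ x y hxy).2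
      exact ⟨_, hN, fun i hi => by rw [hNa i hi, h i hi]⟩
  · intro i hi
    obtain ⟨v, hv, hs, N, -, hN⟩ := h₂ i hi
    exact ⟨v, hv, hs, _, hN⟩

theorem PreservesStrict.of_certificates (L : List ℕ)
    (h₁ : ∀ x y : Fin 3, ∃ N ∈ L, Colors B b [] (digit N) ∧
      (∀ i < 4, digit N i = quad x x y y i) ∧ Paired fun i => digit N (j + i))
    (h₂ : ∀ u < b, ∀ v < b, u ≠ v → (∃ s t, B u s = B v t) → ∃ N ∈ L, Colors B b [u, v] (digit N) ∧
      Passing (digit N) ∧ Paired fun i => digit N (j + i))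
    (h₃ : ∀ l < 4, ∃ v < b, (∃ s, B v s = l) ∧ ∃ N ∈ L, Colors B b [v] (digit N) ∧
      (∀ i < 4, digit N i = pendantPattern l i) ∧ Paired fun i => digit N (j + i))
    (h₄ : ∀ i : Fin 2, ∀ x y : Fin 3, x ≠ y → search B (fold j) (List.range b)
      (2 ^ (6 * i.val + x.val) ||| 2 ^ (6 * i.val + 3 + y.val)) = false) :
    PreservesStrict B b j := by
  refine ⟨fun a ha => ?_, fun u hu v hv huv s t e => ?_, fun l hl => ?_, paired_of_search h₄⟩
  · obtain ⟨x, y, h⟩ := ha.exists_quad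
    obtain ⟨N, -, hN, hNa, hNp⟩ := h₁ x y
    exact ⟨_, hN, fun i hi => by rw [hNa i hi, h i hi], hNp⟩
  · obtain ⟨N, -, hN⟩ := h₂ u hu v hv huv ⟨s, t, e⟩
    exact ⟨_, hN⟩
  · obtain ⟨v, hv, hs, N, -, hN⟩ := h₃ l hl
    exact ⟨v, hv, hs, _, hN⟩

theorem PreservesFlexible.of_certificates (L : List ℕ)
    (h₁ : ∀ x y : Fin 3, x ≠ y →
      (∃ N ∈ L, Colors B b [] (digit N) ∧ Passing (digit N) ∧
        ∀ i < 4, digit N (j + i) = quad x y x y i) ∧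
      ∃ N ∈ L, Colors B b [] (digit N) ∧ Passing (digit N) ∧
        ∀ i < 4, digit N (j + i) = quad x y y x i)
    (h₂ : ∀ i < 4, ∃ v < b, (∃ s, B v s = j + i) ∧ ∃ N ∈ L, Colors B b [v] (digit N) ∧
      Passing (digit N) ∧ ∀ l < 4, digit N (j + l) = pendantPattern i l) :
    PreservesFlexible B b j := by
  constructor
  · intro a ha
    obtain ⟨x, y, hxy, h | h⟩ := ha.exists_quad
    · obtain ⟨N, -, hN, hNp, hNa⟩ := (h₁ x y hxy).1
      exact ⟨_, hN, hNp, fun i hi => by rw [hNa i hi, h i hi]⟩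
    · obtain ⟨N, -, hN, hNp, hNa⟩ := (h₁ x y hxy).2
      exact ⟨_, hN, hNp, fun i hi => by rw [hNa i hi, h i hi]⟩
  · intro i hi
    obtain ⟨v, hv, hs, N, -, hN⟩ := h₂ i hi
    exact ⟨v, hv, hs, _, hN⟩

theorem IsStrict.of_certificates {E₁ E₂ : ℕ → ℕ} (h : HasEnds T n m 4 E₁ E₂) (C : List ℕ)
    (hC : ∀ l < m, Colors T n [E₁ l, E₂ l] (digit (C.getD l 0)) ∧
      Paired fun i => digit (C.getD l 0) (m + i))
    {p q : ℕ} (hp : p < n) (hq : q < n) (hpq : p ≠ q)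
    (hs : search T (fold m) ((List.range n).filter fun v => v ≠ p ∧ v ≠ q) 0 = false) :
    IsStrict T n m :=
  ⟨h.exists_colors fun l hl => ⟨_, hC l hl⟩, p, hp, q, hq, hpq, not_paired_of_search hs⟩

end Certificates

/-! ### The blocks -/

/-- The labels at the vertices of the linking block. -/
def linkTable : List (List ℕ) :=
  [[0, 11, 13], [1, 5, 8], [2, 4, 9], [3, 6, 15], [4, 10, 12], [5, 7, 9], [6, 8, 10],
   [7, 11, 14]]

/-- Colourings of the linking block. -/
def linkCertificates : List ℕ :=
  [2536302, 2543268, 2640501, 4466721, 4480545, 4524924, 5827210, 6812454, 10886693, 11287694,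
   13012599, 15245506, 16463877, 21406436, 21632295, 21756834, 23479708, 23849541, 26582843,
   27645796, 29956412, 30742851, 32160027, 33577203, 33888547, 36156557, 37219510, 38360172,
   38599424, 40555772, 40902501, 42570769, 42629044, 42732147, 42745968, 42764628, 42804243]

set_option synthInstance.maxSize 1000 in
set_option synthInstance.maxHeartbeats 200000 in
theorem isBlock_link : IsBlock (slots linkTable) 8 12 4 := by
  constructor <;> decide +kernel

set_option synthInstance.maxSize 1000 in
set_option synthInstance.maxHeartbeats 200000 in
theorem preservesStrict_link : PreservesStrict (slots linkTable) 8 12 :=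
  .of_certificates linkCertificates (by decide +kernel) (by decide +kernel) (by decide +kernel)
    (by decide +kernel)

theorem preservesFlexible_link : PreservesFlexible (slots linkTable) 8 12 :=
  .of_certificates linkCertificates (by decide +kernel) (by decide +kernel)

/-- The labels at the vertices of the closing block. -/
def capTable : List (List ℕ) :=
  [[0, 5, 13], [1, 6, 9], [2, 4, 11], [3, 7, 10], [4, 5, 12], [6, 8, 11], [7, 9, 12],
   [8, 10, 13]]

/-- Colourings of the closing block. -/
def capCertificates : List ℕ :=
  [521077, 820687, 879366, 1049871, 1050286, 1332206, 1561805, 1986393, 1997328, 2068041,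
   2109564, 2283744, 2638773, 3132602, 3426735, 3593595, 3732753, 4174074, 4262034, 4491633,
   4509180, 4614876, 4727820]

set_option synthInstance.maxSize 1000 in
set_option synthInstance.maxHeartbeats 200000 in
theorem isBlock_cap : IsBlock (slots capTable) 8 14 0 := by
  constructor <;> decide +kernel

set_option synthInstance.maxSize 1000 in
set_option synthInstance.maxHeartbeats 200000 in
theorem preservesStrict_cap : PreservesStrict (slots capTable) 8 14 :=
  .of_certificates capCertificates (by decide +kernel) (by decide +kernel) (by decide +kernel)
    (by decide +kernel)

/-! ### The initial poles -/

/-- The labels at the vertices of the initial pole on 24 vertices. -/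
def pole24Table : List (List ℕ) :=
  [[0, 1, 2], [0, 3, 36], [1, 4, 5], [3, 6, 7], [4, 6, 8], [7, 9, 35], [2, 10, 11],
   [10, 12, 13], [12, 14, 15], [9, 16, 17], [14, 16, 18], [13, 17, 19], [19, 20, 21],
   [15, 20, 22], [22, 23, 34], [5, 23, 24], [24, 25, 37], [21, 26, 27], [8, 26, 28],
   [18, 29, 30], [28, 29, 31], [11, 31, 32], [27, 32, 33], [25, 30, 33]]

/-- The ends of the labels of the initial pole on 24 vertices. -/
def pole24Ends : List (ℕ × ℕ) :=
  [(0, 1), (0, 2), (0, 6), (1, 3), (2, 4), (2, 15), (3, 4), (3, 5), (4, 18), (5, 9), (6, 7),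
   (6, 21), (7, 8), (7, 11), (8, 10), (8, 13), (9, 10), (9, 11), (10, 19), (11, 12), (12, 13),
   (12, 17), (13, 14), (14, 15), (15, 16), (16, 23), (17, 18), (17, 22), (18, 20), (19, 20),
   (19, 23), (20, 21), (21, 22), (22, 23), (14, 14), (5, 5), (1, 1), (16, 16)]

/-- Colourings of the initial pole on 24 vertices with an edge removed. -/
def pole24Critical : List ℕ :=
  [1346764734420311475, 1279461242385172134, 1274758773460431921, 71293773830637684,
   1281744530455604997, 1281744402757736259, 1213347468854165754, 1346764734165139518,
   1281903975445835307, 1204997943364702644, 1346169937777758651, 1345415633573818179,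
   1346610294225588090, 1346610291915414063, 1346610294052338324, 1338415331784536316,
   1338415334176020816, 1346610291699117576, 1346815556783616846, 1348455694645681734,
   1346610286078066119, 1343966126346475653, 1279901567224993917, 741040953292866288,
   1272050701474961316, 1204585879526087709, 1341419189983764348, 1343307795910925736,
   1343854297447303530, 1346787610613195196, 1338002922310490172, 1347356984444324670,
   1340816767782450375, 1338010543793558937]

/-- Colourings of the initial pole on 24 vertices with prescribed dangling edges. -/
def pole24Flexible : List ℕ :=
  [509699414940486751, 1014909589706248306, 171356991726504675, 1174647395054660601,
   347822826117759222, 838443883140451695, 209510426776024749, 413390305721554116,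
   471545979890966677, 873863610286540893, 946512373373143426, 1146638553769140717,
   1063751509975579103, 1064941134805246476, 963688513920755492, 354806239297682910]

theorem hasEnds_pole24 :
    HasEnds (slots pole24Table) 24 34 4 (endOne pole24Ends) (endTwo pole24Ends) := by
  constructor <;> decide +kernel

theorem isStrict_pole24 : IsStrict (slots pole24Table) 24 34 :=
  .of_certificates (p := 14) (q := 5) hasEnds_pole24 pole24Critical (by decide +kernel)
    (by decide) (by decide) (by decide) (by decide +kernel)

theorem isFlexible_pole24 : IsFlexible (slots pole24Table) 24 34 :=
  .of_certificates pole24Flexible (by decide +kernel) (by decide +kernel)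

/-- The labels at the vertices of the initial pole on 26 vertices. -/
def pole26Table : List (List ℕ) :=
  [[0, 1, 40], [0, 2, 3], [2, 4, 5], [3, 6, 7], [6, 8, 9], [4, 8, 10], [10, 11, 12],
   [7, 11, 13], [12, 14, 39], [13, 15, 16], [15, 17, 18], [17, 19, 20], [5, 19, 21],
   [20, 22, 37], [21, 23, 24], [16, 23, 25], [18, 24, 26], [9, 26, 27], [25, 28, 38],
   [28, 29, 30], [1, 29, 31], [27, 32, 33], [30, 32, 34], [31, 33, 35], [14, 34, 36],
   [22, 35, 36]]

/-- The ends of the labels of the initial pole on 26 vertices. -/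
def pole26Ends : List (ℕ × ℕ) :=
  [(0, 1), (0, 20), (1, 2), (1, 3), (2, 5), (2, 12), (3, 4), (3, 7), (4, 5), (4, 17), (5, 6),
   (6, 7), (6, 8), (7, 9), (8, 24), (9, 10), (9, 15), (10, 11), (10, 16), (11, 12), (11, 13),
   (12, 14), (13, 25), (14, 15), (14, 16), (15, 18), (16, 17), (17, 21), (18, 19), (19, 20),
   (19, 22), (20, 23), (21, 22), (21, 23), (22, 24), (23, 25), (24, 25), (13, 13), (18, 18),
   (8, 8), (0, 0)]

/-- Colourings of the initial pole on 26 vertices with an edge removed. -/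
def pole26Critical : List ℕ :=
  [3956079688149786453, 2060812843266840399, 36312145992142738230, 36312143450651598324,
   34511008406110413096, 36312143181148834491, 36312143450651359923, 34511011219196066163,
   36312145992142730112, 34577001069434969223, 36346826016453252405, 36312143450651305248,
   36282482417935329204, 32731386214364525109, 36419424215899513314, 32731388755843037925,
   36376472143662964194, 36162048843007661415, 32731389132128775093, 36162048571425898626,
   34360914066703583592, 36376471947470358783, 36269327042481291321, 32516965549330913973,
   32731388558617311210, 34575336420374071092, 34511008678079609739, 36391285761179452014,
   32747810904100384356, 32615864747737755042, 34601631749307089382, 34518177210431391654,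
   34589964585155059272, 34506578676656726427, 32475858777913393722, 32750105765863466190,
   34232331688706653959]

/-- Colourings of the initial pole on 26 vertices with prescribed dangling edges. -/
def pole26Flexible : List ℕ :=
  [13634639713461769134, 27143202643776599943, 4757581095436063636, 31809304291846366848,
   9319895790458393491, 22892701725390746724, 5529529407423454360, 11121029265675329089,
   12862691401474378410, 23793268590030088194, 25342069168559664345, 30908737427207025378,
   28691999146494819048, 28558398709938906417, 25977126778757544882, 9766906083040022284]

theorem hasEnds_pole26 :
    HasEnds (slots pole26Table) 26 37 4 (endOne pole26Ends) (endTwo pole26Ends) := by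
  constructor <;> decide +kernel

theorem isStrict_pole26 : IsStrict (slots pole26Table) 26 37 :=
  .of_certificates (p := 13) (q := 18) hasEnds_pole26 pole26Critical (by decide +kernel)
    (by decide) (by decide) (by decide) (by decide +kernel)

theorem isFlexible_pole26 : IsFlexible (slots pole26Table) 26 37 :=
  .of_certificates pole26Flexible (by decide +kernel) (by decide +kernel)

/-- The labels at the vertices of the initial pole on 28 vertices. -/
def pole28Table : List (List ℕ) :=
  [[0, 1, 2], [0, 3, 4], [1, 5, 6], [3, 7, 8], [7, 9, 10], [5, 9, 11], [4, 11, 12],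
   [10, 13, 40], [13, 14, 15], [14, 16, 17], [6, 16, 18], [15, 19, 20], [18, 19, 21],
   [21, 22, 23], [2, 22, 24], [23, 25, 26], [20, 25, 27], [8, 27, 28], [12, 28, 29],
   [26, 30, 42], [29, 31, 41], [24, 32, 33], [32, 34, 43], [33, 35, 36], [30, 35, 37],
   [31, 37, 38], [34, 38, 39], [17, 36, 39]]

/-- The ends of the labels of the initial pole on 28 vertices. -/
def pole28Ends : List (ℕ × ℕ) :=
  [(0, 1), (0, 2), (0, 14), (1, 3), (1, 6), (2, 5), (2, 10), (3, 4), (3, 17), (4, 5), (4, 7),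
   (5, 6), (6, 18), (7, 8), (8, 9), (8, 11), (9, 10), (9, 27), (10, 12), (11, 12), (11, 16),
   (12, 13), (13, 14), (13, 15), (14, 21), (15, 16), (15, 19), (16, 17), (17, 18), (18, 20),
   (19, 24), (20, 25), (21, 22), (21, 23), (22, 26), (23, 24), (23, 27), (24, 25), (25, 26),
   (26, 27), (7, 7), (20, 20), (19, 19), (22, 22)]

/-- Colourings of the initial pole on 28 vertices with an edge removed. -/
def pole28Critical : List ℕ :=
  [442724359995144455364, 442724367626165158650, 934502523088846423194, 539985568479713375304,
   542251240750292780568, 981797683817567873676, 442724351569135926114, 983133153687681664230,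
   542251286503876461585, 983032855895913885777, 442724382068011557294, 539985568479713163354,
   542251263627084166275, 493620655176183277155, 884536466906101183293, 884536466906899939116,
   884536466146355255457, 5150532797595678774, 884536466146819203450, 442724351569536140796,
   442724366814131815185, 442724367552167846730, 442319135216737403523, 442724368398629002536,
   878321436954662873325, 442724366898976902276, 882170365840802360949, 542251271255353646943,
   539985545602919870772, 933166991481662249184, 493865235629814156285, 976393766034728236047,
   56141512361118760881, 934541231841614723700, 930640624344081598395, 882420097382627100807,
   927262568539804692252, 932265723049704662952, 53054380726491593775, 926311969182923697819]

/-- Colourings of the initial pole on 28 vertices with prescribed dangling edges. -/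
def pole28Flexible : List ℕ :=
  [372244536872884634955, 732790297455761322212, 126915990122006143729, 857854897599172483361,
   246126524108502631582, 610329612473180288821, 148528983895020548835, 295206580156890288128,
   345707848771441660771, 639512555124643390469, 687647705614225905772, 830051687257419430045,
   775453659623762645148, 774612003469373487240, 703506897122607304035, 262621287485107762272]

theorem hasEnds_pole28 :
    HasEnds (slots pole28Table) 28 40 4 (endOne pole28Ends) (endTwo pole28Ends) := by
  constructor <;> decide +kernel

theorem isStrict_pole28 : IsStrict (slots pole28Table) 28 40 :=
  .of_certificates (p := 7) (q := 20) hasEnds_pole28 pole28Critical (by decide +kernel)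
    (by decide) (by decide) (by decide) (by decide +kernel)

theorem isFlexible_pole28 : IsFlexible (slots pole28Table) 28 40 :=
  .of_certificates pole28Flexible (by decide +kernel) (by decide +kernel)

/-- The labels at the vertices of the initial pole on 30 vertices. -/
def pole30Table : List (List ℕ) :=
  [[0, 1, 2], [0, 3, 4], [3, 5, 6], [5, 7, 8], [7, 9, 46], [8, 10, 11], [1, 10, 12],
   [6, 12, 13], [4, 11, 14], [13, 15, 43], [15, 16, 17], [2, 16, 18], [17, 19, 20],
   [19, 21, 22], [21, 23, 24], [9, 23, 25], [20, 25, 26], [24, 27, 44], [22, 28, 29],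
   [26, 28, 30], [14, 30, 31], [29, 32, 45], [18, 33, 34], [33, 35, 36], [31, 35, 37],
   [32, 38, 39], [36, 38, 40], [27, 40, 41], [34, 41, 42], [37, 39, 42]]

/-- The ends of the labels of the initial pole on 30 vertices. -/
def pole30Ends : List (ℕ × ℕ) :=
  [(0, 1), (0, 6), (0, 11), (1, 2), (1, 8), (2, 3), (2, 7), (3, 4), (3, 5), (4, 15), (5, 6),
   (5, 8), (6, 7), (7, 9), (8, 20), (9, 10), (10, 11), (10, 12), (11, 22), (12, 13), (12, 16),
   (13, 14), (13, 18), (14, 15), (14, 17), (15, 16), (16, 19), (17, 27), (18, 19), (18, 21),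
   (19, 20), (20, 24), (21, 25), (22, 23), (22, 28), (23, 24), (23, 26), (24, 29), (25, 26),
   (25, 29), (26, 27), (27, 28), (28, 29), (9, 9), (17, 17), (21, 21), (4, 4)]

/-- Colourings of the initial pole on 30 vertices with an edge removed. -/
def pole30Critical : List ℕ :=
  [26402683248102140711955, 26402683248102139427052, 14533734386624441082129,
   26331391222289500427346, 26402682840552898118364, 24994249397454679615038,
   23776627510166277415521, 23776627509322358267892, 26402682840552897757158,
   26331391426486049395482, 24994249397454680034699, 26331391222289499307062,
   23764570125443666643729, 25077598219168581120420, 26403887555320002124755,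
   13201112799492882074634, 14533734386624341702683, 2695685379387180615372,
   14628277337031657915213, 14514140688343779171099, 14514140668035584558208,
   14514140689093437817314, 130068629728322678436, 11863970587322713238664,
   14490026327238196180143, 14514140667022092558984, 11863970560418684800548,
   11871222327999212934576, 14514140670607669184679, 11947319299209996720111,
   14586636588351697746966, 14579435248608385483698, 14687089410094120122348,
   14724738977271435869961, 14751655948534697712327, 14509241994408911020866,
   11858770047853981463844, 14505589691616684042255, 14512994360291335998891,
   14531194724586238781193, 14664128539914281002692, 14664289752670711112859,
   14533257136056430880226]

/-- Colourings of the initial pole on 30 vertices with prescribed dangling edges. -/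
def pole30Flexible : List ℕ :=
  [9938136890737342829608, 19785845912385168781081, 3530047140678428278044,
   23225464776424928514298, 6708469715461745162043, 16482477892495160171446,
   4029511430102754311844, 7949001088641922700703, 9438672601313016795808,
   17138991643966551469390, 18512458966531967656705, 22411901605040775951406,
   20927666413432838684725, 20770616766847572516147, 18801075100900955648479,
   6963025838053528931509]

theorem hasEnds_pole30 :
    HasEnds (slots pole30Table) 30 43 4 (endOne pole30Ends) (endTwo pole30Ends) := by
  constructor <;> decide +kernel

theorem isStrict_pole30 : IsStrict (slots pole30Table) 30 43 :=
  .of_certificates (p := 9) (q := 17) hasEnds_pole30 pole30Critical (by decide +kernel)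
    (by decide) (by decide) (by decide) (by decide +kernel)

theorem isFlexible_pole30 : IsFlexible (slots pole30Table) 30 43 :=
  .of_certificates pole30Flexible (by decide +kernel) (by decide +kernel)

theorem exists_graph_of_pole {T : ℕ → Fin 3 → ℕ} {n m : ℕ} (h : IsPole T n m 4)
    (hs : IsStrict T n m) (hf : IsFlexible T n m) (k : ℕ) :
    ∃ G : SimpleGraph (Fin (n + 8 * k + 8)), IsSnark G ∧ StrictlyCritical G := by
  obtain ⟨h, hs, hf⟩ :=
    chain_spec h hs hf isBlock_link preservesStrict_link preservesFlexible_link k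
  exact ⟨_, (h.glue isBlock_cap).isSnark_strictlyCritical_of_isStrict
    (hs.glue h hf isBlock_cap preservesStrict_cap)⟩

/-- For every even integer `n ≥ 32` there exists a strictly critical
snark of order `n`. -/
theorem exists_strictlyCritical_snark_of_even
    (n : ℕ) (hn : Even n) (hn32 : 32 ≤ n) :
    ∃ G : SimpleGraph (Fin n), IsSnark G ∧ StrictlyCritical G := by
  obtain ⟨r, rfl⟩ := hn.two_dvd
  have hr : r % 4 = 0 ∨ r % 4 = 1 ∨ r % 4 = 2 ∨ r % 4 = 3 := by omega
  rcases hr with hr | hr | hr | hr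
  · rw [show 2 * r = 24 + 8 * ((r - 16) / 4) + 8 by omega]
    exact exists_graph_of_pole hasEnds_pole24.isPole isStrict_pole24 isFlexible_pole24 _
  · rw [show 2 * r = 26 + 8 * ((r - 17) / 4) + 8 by omega]
    exact exists_graph_of_pole hasEnds_pole26.isPole isStrict_pole26 isFlexible_pole26 _
  · rw [show 2 * r = 28 + 8 * ((r - 18) / 4) + 8 by omega]
    exact exists_graph_of_pole hasEnds_pole28.isPole isStrict_pole28 isFlexible_pole28 _
  · rw [show 2 * r = 30 + 8 * ((r - 19) / 4) + 8 by omega]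
    exact exists_graph_of_pole hasEnds_pole30.isPole isStrict_pole30 isFlexible_pole30 _
end

section
/- For every even integer n ≥ 32 there exists a strictly critical snark of order n whose cyclic connectivity equals 4. -/
namespace SnarkFamily

/-- `c u v` is the colour of the half of the edge `uv` at `u`. The two halves of an edge have the
same colour unless the edge is in `D`, and colours at a vertex are distinct unless it is in `S`. -/
structure IsDartColoring {V : Type} (G : SimpleGraph V) (D : V → V → Prop) (S : Set V)
    (c : V → V → Fin 3) : Prop where
  symm : ∀ ⦃u v⦄, G.Adj u v → ¬ D u v → c u v = c v u
  proper : ∀ ⦃u v w⦄, u ∉ S → G.Adj u v → G.Adj u w → v ≠ w → c u v ≠ c u w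

/-- Existence of a colouring of the edges which is proper at all vertices outside `S`. -/
def ColorableOff {V : Type} (G : SimpleGraph V) (S : Set V) : Prop :=
  ∃ c, IsDartColoring G (fun _ _ ↦ False) S c

theorem IsDartColoring.comp {V : Type} {G : SimpleGraph V} {D : V → V → Prop} {S : Set V}
    {c : V → V → Fin 3} (h : IsDartColoring G D S c) {σ : Fin 3 → Fin 3} (hσ : σ.Injective) :
    IsDartColoring G D S (fun u v ↦ σ (c u v)) where
  symm _ _ ha hd := congrArg σ (h.symm ha hd)
  proper _ _ _ hu hv hw hne heq := h.proper hu hv hw hne (hσ heq)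

/-- The number of edges of `G` between the two classes of `χ`. -/
noncomputable def cutSize {V : Type} [Fintype V] (G : SimpleGraph V) (χ : V → Bool) : ℕ :=
  open scoped Classical in
  ∑ u, ∑ v, if χ u = true ∧ χ v = false ∧ G.Adj u v then 1 else 0

/-- Edge cuts have at least three edges, and at least four unless one side is a single vertex. -/
def WellConnected {V : Type} [Fintype V] (G : SimpleGraph V) : Prop :=
  ∀ χ : V → Bool, (∃ u, χ u = true) → (∃ u, χ u = false) → 3 ≤ cutSize G χ ∧
    ((∃ u v, u ≠ v ∧ χ u = true ∧ χ v = true) →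
      (∃ u v, u ≠ v ∧ χ u = false ∧ χ v = false) → 4 ≤ cutSize G χ)

/-- There is a four-edge cut with a 5-cycle on either side. -/
def HasFourCut {V : Type} (G : SimpleGraph V) : Prop :=
  ∃ (χ : V → Bool) (x y : Fin 4 → V) (f g : Fin 5 → V),
    (∀ u v, χ u = true → χ v = false → G.Adj u v → ∃ i, u = x i ∧ v = y i) ∧
    f.Injective ∧ g.Injective ∧ (∀ i, χ (f i) = true ∧ G.Adj (f i) (f (i + 1))) ∧
    (∀ i, χ (g i) = false ∧ G.Adj (g i) (g (i + 1)))

/-- A form of the properties required of the final graph that is easy to verify. -/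
structure IsGood {V : Type} [Fintype V] (G : SimpleGraph V) : Prop where
  cubic : IsCubic G
  wellConnected : WellConnected G
  not_colorable : ¬ ColorableOff G ∅
  critical : ∀ u v, G.Adj u v → ColorableOff G {u, v}
  not_bicritical : ∃ u v, u ≠ v ∧ ¬ ColorableOff G {u, v}
  fourCut : HasFourCut G

section Transport

variable {V W : Type} {G : SimpleGraph V} {H : SimpleGraph W}

theorem ColorableOff.of_iso (φ : G ≃g H) {S : Set W} (h : ColorableOff H S) :
    ColorableOff G (φ ⁻¹' S) := by
  obtain ⟨c, hc⟩ := h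
  refine ⟨fun u v ↦ c (φ u) (φ v), fun u v h hd ↦ hc.symm (φ.map_adj_iff.2 h) hd, ?_⟩
  intro u v w hu hv hw hne
  exact hc.proper hu (φ.map_adj_iff.2 hv) (φ.map_adj_iff.2 hw) fun h ↦ hne (φ.injective h)

theorem preimage_iso_pair (φ : G ≃g H) (u v : V) : φ ⁻¹' {φ u, φ v} = {u, v} := by
  ext x; simp

theorem cutSize_of_iso [Fintype V] [Fintype W] (φ : G ≃g H) (χ : W → Bool) :
    cutSize G (χ ∘ φ) = cutSize H χ := by
  classical
  unfold cutSize
  rw [← Equiv.sum_comp φ.toEquiv]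
  refine Finset.sum_congr rfl fun u _ ↦ ?_
  rw [← Equiv.sum_comp φ.toEquiv]
  refine Finset.sum_congr rfl fun v _ ↦ ?_
  have : H.Adj (φ.toEquiv u) (φ.toEquiv v) ↔ G.Adj u v := φ.map_adj_iff
  simp only [this]
  rfl

theorem IsGood.of_iso [Fintype V] [Fintype W] (φ : G ≃g H) (hG : IsGood G) : IsGood H where
  cubic v := by
    have h := hG.cubic (φ.symm v)
    rw [← h]
    have : H.neighborSet v = φ '' G.neighborSet (φ.symm v) := by
      ext w
      simp only [SimpleGraph.mem_neighborSet, Set.mem_image]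
      constructor
      · intro hw
        exact ⟨φ.symm w, φ.symm.map_adj_iff.2 hw, by simp⟩
      · rintro ⟨x, hx, rfl⟩
        simpa using φ.map_adj_iff.2 hx
    rw [this, Set.ncard_image_of_injective _ φ.injective]
  wellConnected χ := by
    rintro ⟨u, hu⟩ ⟨v, hv⟩
    rw [← cutSize_of_iso φ]
    obtain ⟨h3, h4⟩ := hG.wellConnected (χ ∘ φ) ⟨φ.symm u, by simpa using hu⟩
      ⟨φ.symm v, by simpa using hv⟩
    refine ⟨h3, ?_⟩
    rintro ⟨a, b, hab, ha, hb⟩ ⟨a', b', hab', ha', hb'⟩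
    exact h4 ⟨φ.symm a, φ.symm b, fun h ↦ hab (φ.symm.injective h), by simpa using ha,
      by simpa using hb⟩ ⟨φ.symm a', φ.symm b', fun h ↦ hab' (φ.symm.injective h),
      by simpa using ha', by simpa using hb'⟩
  not_colorable h := hG.not_colorable (by simpa using h.of_iso φ)
  critical u v h := by
    have := (hG.critical _ _ (φ.symm.map_adj_iff.2 h)).of_iso φ.symm
    rwa [preimage_iso_pair] at this
  not_bicritical := by
    obtain ⟨u, v, hne, h⟩ := hG.not_bicritical
    refine ⟨φ u, φ v, fun h ↦ hne (φ.injective h), fun hc ↦ h ?_⟩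
    simpa only [preimage_iso_pair] using hc.of_iso φ
  fourCut := by
    obtain ⟨χ, x, y, f, g, h1, hf, hg, hf', hg'⟩ := hG.fourCut
    refine ⟨χ ∘ φ.symm, φ ∘ x, φ ∘ y, φ ∘ f, φ ∘ g, ?_, φ.injective.comp hf, φ.injective.comp hg,
      fun i ↦ ⟨by simpa using (hf' i).1, φ.map_adj_iff.2 (hf' i).2⟩,
      fun i ↦ ⟨by simpa using (hg' i).1, φ.map_adj_iff.2 (hg' i).2⟩⟩
    intro u v hu hv ha
    obtain ⟨i, hi, hi'⟩ := h1 _ _ hu hv (φ.symm.map_adj_iff.2 ha)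
    exact ⟨i, by simp [← hi], by simp [← hi']⟩

end Transport

section Bridge

variable {V : Type} {G : SimpleGraph V}

theorem exists_kol_equiv : Nonempty (Kol ≃ Fin 3) :=
  ⟨Fintype.equivFinOfCardEq (by decide)⟩

theorem ColorableOff.of_threeEdgeColorable (h : ThreeEdgeColorable G) : ColorableOff G ∅ := by
  obtain ⟨f, hf⟩ := h
  obtain ⟨e⟩ := exists_kol_equiv
  refine ⟨fun u v ↦ e (f s(u, v)), fun u v _ _ ↦ by rw [Sym2.eq_swap], ?_⟩
  intro u v w _ hv hw hne h
  refine hf s(u, v) hv s(u, w) hw ?_ ⟨u, by simp, by simp⟩ (e.injective h)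
  exact fun h ↦ hne (Sym2.congr_right.1 h)

theorem ColorableOff.threeEdgeColorable_induce {S : Set V} (h : ColorableOff G S) :
    ThreeEdgeColorable (G.induce Sᶜ) := by
  classical
  obtain ⟨c, hc⟩ := h
  obtain ⟨e⟩ := exists_kol_equiv
  let f : Sym2 (Sᶜ : Set V) → Kol := fun z ↦
    if z ∈ (G.induce Sᶜ).edgeSet then e.symm (c z.out.1 z.out.2) else e.symm 0
  have key : ∀ u v : (Sᶜ : Set V), G.Adj u v → f s(u, v) = e.symm (c u v) := by
    intro u v h
    have hm : s(u, v) ∈ (G.induce Sᶜ).edgeSet := h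
    simp only [f, if_pos hm]
    have ho : s((s(u, v)).out.1, (s(u, v)).out.2) = s(u, v) := Quot.out_eq _
    rcases Sym2.eq_iff.1 ho with ⟨h1, h2⟩ | ⟨h1, h2⟩
    · rw [h1, h2]
    · rw [h1, h2, hc.symm h.symm id]
  refine ⟨f, ?_⟩
  intro e₁ h₁ e₂ h₂ hne ⟨u, hu₁, hu₂⟩
  obtain ⟨v, rfl⟩ := hu₁
  obtain ⟨w, rfl⟩ := hu₂
  rw [key u v h₁, key u w h₂]
  intro heq
  refine hc.proper u.2 h₁ h₂ ?_ (e.symm.injective heq)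
  intro hvw
  have hvw' : v = w := Subtype.ext hvw
  exact hne (by rw [hvw'])

theorem exists_injOn_extension {N S : Set V} (hN : N.ncard = 3) (f : V → Fin 3)
    (hf : Set.InjOn f (N \ S)) : ∃ g : V → Fin 3, Set.InjOn g N ∧ ∀ v ∈ N \ S, g v = f v := by
  classical
  have hfin : N.Finite := Set.finite_of_ncard_pos (by omega)
  have := hfin.fintype
  have hcard : Fintype.card N = (Finset.univ : Finset (Fin 3)).card := by
    rw [← Nat.card_eq_fintype_card, Nat.card_coe_set_eq, hN]; rfl
  obtain ⟨g, hg⟩ := Finset.exists_equiv_extend_of_card_eq (α := N) hcard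
    (s := Finset.univ.filter fun x : N ↦ (x : V) ∉ S) (f := fun x ↦ f x) (by simp) (by
      intro x hx y hy hxy
      simp only [Finset.coe_filter, Finset.mem_univ, true_and, Set.mem_ofPred_eq] at hx hy
      exact Subtype.ext (hf ⟨x.2, hx⟩ ⟨y.2, hy⟩ hxy))
  refine ⟨fun v ↦ if h : v ∈ N then (g ⟨v, h⟩ : Fin 3) else 0, ?_, ?_⟩
  · intro x hx y hy hxy
    simp only [hx, hy, dif_pos] at hxy
    have := g.injective (Subtype.ext hxy)
    simpa using this
  · rintro v ⟨hv, hvS⟩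
    simp only [hv, dif_pos]
    exact hg ⟨v, hv⟩ (by simpa using hvS)

theorem ColorableOff.of_induce (hG : IsCubic G) {S : Set V}
    (h : ThreeEdgeColorable (G.induce Sᶜ)) : ColorableOff G S := by
  classical
  obtain ⟨f, hf⟩ := h
  obtain ⟨e⟩ := exists_kol_equiv
  let c : V → V → Fin 3 := fun u v ↦
    if h : u ∉ S ∧ v ∉ S then e (f s(⟨u, h.1⟩, ⟨v, h.2⟩)) else 0
  have csymm : ∀ u v, c u v = c v u := by
    intro u v
    by_cases h : u ∉ S ∧ v ∉ S
    · simp only [c, dif_pos h, dif_pos h.symm]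
      rw [Sym2.eq_swap]
    · simp only [c, dif_neg h, dif_neg (fun h' ↦ h (And.symm h'))]
  have hinj : ∀ u ∉ S, Set.InjOn (c u) (G.neighborSet u \ S) := by
    rintro u hu v ⟨hv, hvS⟩ w ⟨hw, hwS⟩ heq
    by_contra hne
    simp only [c, hu, hvS, hwS, not_false_eq_true, and_self, dif_pos] at heq
    refine hf s(⟨u, hu⟩, ⟨v, hvS⟩) hv s(⟨u, hu⟩, ⟨w, hwS⟩) hw ?_
      ⟨⟨u, hu⟩, by simp, by simp⟩ (e.injective heq)
    exact fun h ↦ hne (congrArg Subtype.val (Sym2.congr_right.1 h))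
  have hex : ∀ u, ∃ g : V → Fin 3, u ∉ S → Set.InjOn g (G.neighborSet u) ∧
      ∀ v ∈ G.neighborSet u \ S, g v = c u v := by
    intro u
    by_cases hu : u ∈ S
    · exact ⟨fun _ ↦ 0, fun h ↦ absurd hu h⟩
    · obtain ⟨g, hg⟩ := exists_injOn_extension (hG u) (c u) (hinj u hu)
      exact ⟨g, fun _ ↦ hg⟩
  choose g hg using hex
  refine ⟨fun u v ↦ if u ∈ S then (if v ∈ S then 0 else g v u) else g u v, ?_, ?_⟩
  · intro u v ha _
    by_cases hu : u ∈ S <;> by_cases hv : v ∈ S <;> simp only [hu, hv, if_true, if_false]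
    rw [(hg u hu).2 v ⟨ha, hv⟩, (hg v hv).2 u ⟨ha.symm, hu⟩, csymm]
  · intro u v w hu hv hw hne
    simp only [hu, if_false]
    exact fun h ↦ hne ((hg u hu).1 hv hw h)

theorem exists_isCycle_of_fin_five {H : SimpleGraph V} {f : Fin 5 → V} (hf : f.Injective)
    (h : ∀ i, H.Adj (f i) (f (i + 1))) : ∃ w : H.Walk (f 0) (f 0), w.IsCycle := by
  have ne : ∀ i j : Fin 5, i ≠ j → f i ≠ f j := fun i j hij h ↦ hij (hf h)
  refine ⟨.cons (h 0) (.cons (h 1) (.cons (h 2) (.cons (h 3) (.cons (h 4) .nil)))), ?_⟩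
  rw [SimpleGraph.Walk.cons_isCycle_iff]
  constructor
  · simp [SimpleGraph.Walk.isPath_def, hf.eq_iff]
  · simp [hf.eq_iff]

theorem HasFourCut.not_cyclicallyConnected (h : HasFourCut G) : ¬ CyclicallyConnected G 5 := by
  classical
  obtain ⟨χ, x, y, f, g, h1, hf, hg, hf', hg'⟩ := h
  let F : Set (Sym2 V) := {e | ∃ u v, χ u = true ∧ χ v = false ∧ G.Adj u v ∧ e = s(u, v)}
  have hF : F.ncard ≤ 4 := by
    have hsub : F ⊆ Set.range fun i ↦ s(x i, y i) := by
      rintro e ⟨u, v, hu, hv, ha, rfl⟩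
      obtain ⟨i, rfl, rfl⟩ := h1 u v hu hv ha
      exact ⟨i, rfl⟩
    refine (Set.ncard_le_ncard hsub (Set.toFinite _)).trans ?_
    rw [← Set.image_univ]
    refine (Set.ncard_image_le (Set.toFinite _)).trans ?_
    simp [Set.ncard_univ]
  have hmem : ∀ u v, G.Adj u v → (s(u, v) ∈ F ↔ χ u ≠ χ v) := by
    intro u v ha
    constructor
    · rintro ⟨u', v', hu, hv, -, heq⟩
      rcases Sym2.eq_iff.1 heq with ⟨rfl, rfl⟩ | ⟨rfl, rfl⟩ <;> simp [hu, hv]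
    · intro hne
      cases hu : χ u <;> cases hv : χ v
      · simp [hu, hv] at hne
      · exact ⟨v, u, hv, hu, ha.symm, Sym2.eq_swap⟩
      · exact ⟨u, v, hu, hv, ha, rfl⟩
      · simp [hu, hv] at hne
  have hreach : ∀ u v, (G.deleteEdges F).Reachable u v → χ u = χ v := by
    rintro u v ⟨w⟩
    induction w with
    | nil => rfl
    | cons ha p ih =>
      rw [SimpleGraph.deleteEdges_adj] at ha
      rw [← ih]
      by_contra hne
      exact ha.2 ((hmem _ _ ha.1).2 hne)
  intro hcc
  refine hcc ⟨F, ?_, by omega, f 0, g 0, exists_isCycle_of_fin_five hf fun i ↦ ?_,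
    exists_isCycle_of_fin_five hg fun i ↦ ?_, fun hr ↦ ?_⟩
  · rintro e ⟨u, v, -, -, ha, rfl⟩
    exact ha
  · rw [SimpleGraph.deleteEdges_adj, hmem _ _ (hf' i).2, (hf' i).1, (hf' (i + 1)).1]
    exact ⟨(hf' i).2, by simp⟩
  · rw [SimpleGraph.deleteEdges_adj, hmem _ _ (hg' i).2, (hg' i).1, (hg' (i + 1)).1]
    exact ⟨(hg' i).2, by simp⟩
  · have := hreach _ _ hr
    simp [(hf' 0).1, (hg' 0).1] at this

variable [Fintype V]

theorem cutSize_le_ncard (χ : V → Bool) (F : Set (Sym2 V))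
    (hF : ∀ u v, χ u = true → χ v = false → G.Adj u v → s(u, v) ∈ F) :
    cutSize G χ ≤ F.ncard := by
  classical
  have h1 : cutSize G χ = ((Finset.univ : Finset (V × V)).filter
      fun p ↦ χ p.1 = true ∧ χ p.2 = false ∧ G.Adj p.1 p.2).card := by
    rw [Finset.card_filter, ← Finset.univ_product_univ, Finset.sum_product]
    unfold cutSize
    congr!
  rw [h1, ← Set.ncard_coe_finset]
  refine Set.ncard_le_ncard_of_injOn (fun p ↦ s(p.1, p.2)) ?_ ?_ (Set.toFinite F)
  · rintro ⟨u, v⟩ h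
    simp only [Finset.coe_filter, Finset.mem_univ, true_and, Set.mem_ofPred_eq] at h
    exact hF u v h.1 h.2.1 h.2.2
  · rintro ⟨u, v⟩ h ⟨u', v'⟩ h' heq
    simp only [Finset.coe_filter, Finset.mem_univ, true_and, Set.mem_ofPred_eq] at h h'
    rcases Sym2.eq_iff.1 heq with ⟨h1, h2⟩ | ⟨h1, h2⟩
    · simp only at h1 h2; rw [h1, h2]
    · simp only at h1 h2
      subst h1 h2
      simp [h.1] at h'

theorem WellConnected.connected (h : WellConnected G) [Nonempty V] : G.Connected := by
  classical
  rw [SimpleGraph.connected_iff]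
  refine ⟨fun u v ↦ ?_, inferInstance⟩
  by_contra huv
  have h3 := (h (fun x ↦ decide (G.Reachable u x)) ⟨u, by simp⟩ ⟨v, by simpa using huv⟩).1
  have h0 := cutSize_le_ncard (G := G) (fun x ↦ decide (G.Reachable u x)) ∅ (by
    intro x y hx hy ha
    simp only [decide_eq_true_eq, decide_eq_false_iff_not] at hx hy
    exact hy (hx.trans ha.reachable))
  simp only [Set.ncard_empty] at h0
  omega

theorem WellConnected.cyclicallyConnected (h : WellConnected G) : CyclicallyConnected G 4 := by
  classical
  rintro ⟨F, hF, hcard, a, b, ⟨w, hw⟩, ⟨w', hw'⟩, hab⟩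
  have hnb : ∀ x, ∀ w : (G.deleteEdges F).Walk x x, w.IsCycle →
      ∃ y, (G.deleteEdges F).Adj x y := by
    intro x w hw
    cases w with
    | nil => exact absurd hw SimpleGraph.Walk.not_isCycle_nil
    | cons h p => exact ⟨_, h⟩
  obtain ⟨a', ha'⟩ := hnb a w hw
  obtain ⟨b', hb'⟩ := hnb b w' hw'
  let χ : V → Bool := fun x ↦ decide ((G.deleteEdges F).Reachable a x)
  have h4 := (h χ ⟨a, by simp [χ]⟩ ⟨b, by simpa [χ] using hab⟩).2
    ⟨a, a', ha'.ne, by simp [χ], by simpa [χ] using ha'.reachable⟩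
    ⟨b, b', hb'.ne, by simpa [χ] using hab, by
      simpa [χ] using fun hr : (G.deleteEdges F).Reachable a b' ↦
        hab (hr.trans hb'.symm.reachable)⟩
  have h0 := cutSize_le_ncard (G := G) χ F (by
    intro x y hx hy ha
    simp only [χ, decide_eq_true_eq, decide_eq_false_iff_not] at hx hy
    by_contra hF
    exact hy (hx.trans (SimpleGraph.Adj.reachable
      (by rw [SimpleGraph.deleteEdges_adj]; exact ⟨ha, hF⟩))))
  omega

theorem IsGood.cyclicConnectivity_eq (h : IsGood G) : cyclicConnectivity G = 4 := by
  refine IsGreatest.csSup_eq ⟨⟨?_, h.wellConnected.cyclicallyConnected⟩, ?_⟩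
  · obtain ⟨χ, x, y, f, g, -, hf, hg, hf', hg'⟩ := h.fourCut
    have h4 := (h.wellConnected χ ⟨f 0, (hf' 0).1⟩ ⟨g 0, (hg' 0).1⟩).2
      ⟨f 0, f 1, fun h ↦ absurd (hf h) (by decide), (hf' 0).1, (hf' 1).1⟩
      ⟨g 0, g 1, fun h ↦ absurd (hg h) (by decide), (hg' 0).1, (hg' 1).1⟩
    exact h4.trans (cutSize_le_ncard χ _ fun u v _ _ ha ↦ ha)
  · rintro k ⟨-, hk⟩
    by_contra! hlt
    refine h.fourCut.not_cyclicallyConnected ?_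
    rintro ⟨F, hF, hcard, hrest⟩
    exact hk ⟨F, hF, by omega, hrest⟩

theorem IsGood.conclusion (h : IsGood G) :
    IsSnark G ∧ StrictlyCritical G ∧ cyclicConnectivity G = 4 := by
  obtain ⟨p, q, hpq, hnc⟩ := h.not_bicritical
  have : Nonempty V := ⟨p⟩
  exact ⟨⟨h.wellConnected.connected, h.cubic,
      fun hc ↦ h.not_colorable (.of_threeEdgeColorable hc)⟩,
    ⟨fun u v ha ↦ (h.critical u v ha).threeEdgeColorable_induce,
      fun hb ↦ hnc (.of_induce h.cubic (hb p q hpq))⟩, h.cyclicConnectivity_eq⟩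

end Bridge

section Petersen

/-- The positions of the two halves of two marked edges: `j` and `mate j` are opposite halves. -/
def mate : Fin 4 → Fin 4 := ![1, 0, 3, 2]

/-- The vertices of the Petersen graph minus two adjacent vertices that have a dangling edge. -/
def port : Fin 4 → Fin 8 := ![0, 1, 2, 3]

/-- A left inverse of `port`. -/
def unport : Fin 8 → Fin 4 := ![0, 1, 2, 3, 0, 0, 0, 0]

/-- The ends of the two edges of the Petersen fragment that are marked in a dot product. -/
def newPort : Fin 4 → Fin 8 := ![0, 4, 1, 5]

/-- Adjacency in the Petersen graph minus two adjacent vertices; `none` is the end of a dangling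
edge. -/
def petAdj (i : Fin 8) : Option (Fin 8) → Bool
  | none => decide (i.val < 4)
  | some j => [(0, 4), (0, 7), (1, 5), (1, 6), (2, 4), (2, 5), (3, 6), (3, 7), (4, 6),
      (5, 7)].any fun e : ℕ × ℕ ↦ e == (i.val, j.val) || e == (j.val, i.val)

theorem petAdj_comm : ∀ i j, petAdj i (some j) = petAdj j (some i) := by decide +kernel

theorem petAdj_self : ∀ i, ¬ petAdj i (some i) = true := by decide +kernel

theorem petAdj_card : ∀ i, (Finset.univ.filter fun x ↦ petAdj i x = true).card = 3 := by
  decide +kernel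

/-- Colourings of the Petersen fragment; the edges in `E` are cut and the vertices in `T` are
exempt. -/
def IsPetColoring (E : Fin 8 → Fin 8 → Bool) (T : Fin 8 → Bool)
    (k : Fin 8 → Option (Fin 8) → Fin 3) : Prop :=
  (∀ i j, petAdj i (some j) = true → E i j = false → k i (some j) = k j (some i)) ∧
  ∀ i, T i = false → ∀ x, petAdj i x = true → ∀ y, petAdj i y = true → x ≠ y → k i x ≠ k i y

instance (E : Fin 8 → Fin 8 → Bool) (T : Fin 8 → Bool) (k : Fin 8 → Option (Fin 8) → Fin 3) :
    Decidable (IsPetColoring E T k) := by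
  unfold IsPetColoring; infer_instance

/-- The colouring of the Petersen fragment with the given base 4 digits. -/
def petColor (N : ℕ) (i : Fin 8) (x : Option (Fin 8)) : Fin 3 :=
  Fin.ofNat 3 (N / 4 ^ (9 * i.val + x.elim 8 Fin.val) % 4)

/-- The colours required of the halves of the marked edges. In the first two cases the colouring is
proper, in the others one end of a marked edge is exempt. -/
def pattern : Fin 6 → Fin 4 → Fin 3 :=
  ![![0, 1, 0, 1], ![0, 1, 1, 0], ![0, 2, 0, 1], ![2, 0, 0, 1], ![0, 1, 0, 2], ![0, 1, 2, 0]]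

/-- The end of a marked edge that is exempt in `pattern s`. -/
def exempt (s : Fin 6) (j : Fin 4) : Bool := decide (s.val = j.val + 2)

theorem exists_petColoring_intact (p r : Fin 3) :
    ∃ k, IsPetColoring (fun _ _ ↦ false) (fun _ ↦ false) k ∧
      ∀ j, k (port j) none = ![p, p, r, r] j := by
  have hperm : ∃ f : Fin 3 → Fin 3, f.Injective ∧
      (p = f 0 ∧ r = f 0 ∨ p = f 0 ∧ r = f 1) := by
    revert p r; decide +kernel
  have hcomp : ∀ f : Fin 3 → Fin 3, f.Injective → ∀ k,
      IsPetColoring (fun _ _ ↦ false) (fun _ ↦ false) k →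
      IsPetColoring (fun _ _ ↦ false) (fun _ ↦ false) fun i x ↦ f (k i x) :=
    fun f hf k hk ↦ ⟨fun i j ha he ↦ congrArg f (hk.1 i j ha he),
      fun i hi x hx y hy hne h ↦ hk.2 i hi x hx y hy hne (hf h)⟩
  obtain ⟨f, hf, ⟨rfl, rfl⟩ | ⟨rfl, rfl⟩⟩ := hperm
  · refine ⟨_, hcomp f hf (petColor 5614701890674278276697281423838518739200) (by decide +kernel),
      fun j ↦ ?_⟩
    fin_cases j <;> exact congrArg f (by decide +kernel)
  · refine ⟨_, hcomp f hf (petColor 87282469971962112071815739695780696457472) (by decide +kernel),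
      fun j ↦ ?_⟩
    fin_cases j <;> exact congrArg f (by decide +kernel)

theorem exists_petColoring_off_port (j : Fin 4) :
    ∃ k, IsPetColoring (fun _ _ ↦ false) (fun i ↦ decide (i = port j)) k ∧
      ∀ l, k (port l) none = pattern ⟨j.val + 2, by omega⟩ l := by
  suffices h : ∃ N ∈ [98001489145126027673506688625089024360448,
      174309767110959978488165641285883702427648, 87282450500878603128261782114595191685376,
      5614845976912141152600695357152748929280],
      IsPetColoring (fun _ _ ↦ false) (fun i ↦ decide (i = port j)) (petColor N) ∧
        ∀ l, petColor N (port l) none = pattern ⟨j.val + 2, by omega⟩ l by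
    obtain ⟨N, -, hN⟩ := h
    exact ⟨_, hN⟩
  revert j; decide +kernel

theorem exists_petColoring_off_edge (i j : Fin 8) (h : petAdj i (some j) = true) :
    ∃ k, IsPetColoring (fun _ _ ↦ false) (fun l ↦ decide (l = i ∨ l = j)) k ∧
      ∃ s : Fin 6, exempt s = (fun _ ↦ false) ∧ ∀ l, k (port l) none = pattern s l := by
  suffices h : ∃ N ∈ [98001407366450486407158425435688937717760,
      185113693318473335692363292950908230434816, 87282469971972015592130018304765649256704,
      10974106333244831374881589060647746814464, 87282551750637653187048270894568136802560,
      10974192006098450625378436073765487002112, 5614659054225195365402363715387643691264,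
      174394736452901452336728194265590563635456, 87282471270066037190907627848651426005248,
      11059200290266363625786184388921111118080],
      IsPetColoring (fun _ _ ↦ false) (fun l ↦ decide (l = i ∨ l = j)) (petColor N) ∧
      ∃ s : Fin 6, exempt s = (fun _ ↦ false) ∧ ∀ l, petColor N (port l) none = pattern s l by
    obtain ⟨N, -, hN⟩ := h
    exact ⟨_, hN⟩
  revert i j; decide +kernel

theorem exists_petColoring_marked (s : Fin 6) :
    ∃ k, IsPetColoring
        (fun i j ↦ decide (∃ l, i = newPort l ∧ j = newPort (mate l)))
        (fun i ↦ decide (∃ l, exempt s l = true ∧ i = newPort l)) k ∧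
      (∀ l, k (newPort l) (some (newPort (mate l))) = pattern s l) ∧
      ∃ f : Fin 3 → Fin 3, f.Injective ∧ ∃ s' : Fin 6, exempt s' = (fun _ ↦ false) ∧
        ∀ l, k (port l) none = f (pattern s' l) := by
  suffices h : ∃ N ∈ [5614826505813776929755904763017121857536,
      87282614058229685509842585509965062045696, 179669132611274362673895538043811948134400,
      10974192006143016532905840682166562865664, 87282450500848892567318937350876931653632,
      5614701890644567715754436730471823015936],
      IsPetColoring (fun i j ↦ decide (∃ l, i = newPort l ∧ j = newPort (mate l)))
        (fun i ↦ decide (∃ l, exempt s l = true ∧ i = newPort l)) (petColor N) ∧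
      (∀ l, petColor N (newPort l) (some (newPort (mate l))) = pattern s l) ∧
      ∃ f : Fin 3 → Fin 3, f.Injective ∧ ∃ s' : Fin 6, exempt s' = (fun _ ↦ false) ∧
        ∀ l, petColor N (port l) none = f (pattern s' l) by
    obtain ⟨N, -, hN⟩ := h
    exact ⟨_, hN⟩
  revert s; decide +kernel

set_option synthInstance.maxHeartbeats 400000 in
set_option synthInstance.maxSize 4096 in
theorem IsPetColoring.mate_eq {k : Fin 8 → Option (Fin 8) → Fin 3}
    (hk : IsPetColoring (fun _ _ ↦ false) (fun _ ↦ false) k) (j : Fin 4) :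
    k (port j) none = k (port (mate j)) none := by
  have key : ∀ t₀ e₀₄ : Fin 3, t₀ ≠ e₀₄ → ∀ e₀₇, t₀ ≠ e₀₇ → e₀₄ ≠ e₀₇ →
      ∀ e₂₄, e₀₄ ≠ e₂₄ → ∀ e₄₆, e₀₄ ≠ e₄₆ → e₂₄ ≠ e₄₆ →
      ∀ e₃₇, e₀₇ ≠ e₃₇ → ∀ e₅₇, e₀₇ ≠ e₅₇ → e₃₇ ≠ e₅₇ →
      ∀ e₂₅, e₂₄ ≠ e₂₅ → e₂₅ ≠ e₅₇ → ∀ e₁₅, e₁₅ ≠ e₂₅ → e₁₅ ≠ e₅₇ →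
      ∀ e₃₆, e₃₆ ≠ e₃₇ → e₃₆ ≠ e₄₆ → ∀ e₁₆, e₁₆ ≠ e₃₆ → e₁₆ ≠ e₄₆ → e₁₅ ≠ e₁₆ →
      ∀ t₁, t₁ ≠ e₁₅ → t₁ ≠ e₁₆ → ∀ t₂, t₂ ≠ e₂₄ → t₂ ≠ e₂₅ → ∀ t₃, t₃ ≠ e₃₆ → t₃ ≠ e₃₇ →
      t₀ = t₁ ∧ t₂ = t₃ := by
    decide +kernel
  have hs : ∀ i j, petAdj i (some j) = true → k i (some j) = k j (some i) :=
    fun i j h ↦ hk.1 i j h rfl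
  have hp : ∀ i x y, petAdj i x = true → petAdj i y = true → x ≠ y → k i x ≠ k i y :=
    fun i x y hx hy ↦ hk.2 i rfl x hx y hy
  have s40 := hs 4 0 (by decide)
  have s70 := hs 7 0 (by decide)
  have s51 := hs 5 1 (by decide)
  have s61 := hs 6 1 (by decide)
  have s42 := hs 4 2 (by decide)
  have s52 := hs 5 2 (by decide)
  have s63 := hs 6 3 (by decide)
  have s73 := hs 7 3 (by decide)
  have s64 := hs 6 4 (by decide)
  have s75 := hs 7 5 (by decide)
  obtain ⟨h1, h2⟩ := key (k 0 none) (k 0 (some 4)) (hp _ _ _ (by decide) (by decide) (by decide))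
    (k 0 (some 7)) (hp _ _ _ (by decide) (by decide) (by decide))
    (hp _ _ _ (by decide) (by decide) (by decide))
    (k 2 (some 4)) (by rw [← s40, ← s42]; exact hp _ _ _ (by decide) (by decide) (by decide))
    (k 4 (some 6)) (by rw [← s40]; exact hp _ _ _ (by decide) (by decide) (by decide))
    (by rw [← s42]; exact hp _ _ _ (by decide) (by decide) (by decide))
    (k 3 (some 7)) (by rw [← s70, ← s73]; exact hp _ _ _ (by decide) (by decide) (by decide))
    (k 5 (some 7)) (by rw [← s70, ← s75]; exact hp _ _ _ (by decide) (by decide) (by decide))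
    (by rw [← s73, ← s75]; exact hp _ _ _ (by decide) (by decide) (by decide))
    (k 2 (some 5)) (hp _ _ _ (by decide) (by decide) (by decide))
    (by rw [← s52]; exact hp _ _ _ (by decide) (by decide) (by decide))
    (k 1 (some 5)) (by rw [← s51, ← s52]; exact hp _ _ _ (by decide) (by decide) (by decide))
    (by rw [← s51]; exact hp _ _ _ (by decide) (by decide) (by decide))
    (k 3 (some 6)) (hp _ _ _ (by decide) (by decide) (by decide))
    (by rw [← s63, ← s64]; exact hp _ _ _ (by decide) (by decide) (by decide))
    (k 1 (some 6)) (by rw [← s61, ← s63]; exact hp _ _ _ (by decide) (by decide) (by decide))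
    (by rw [← s61, ← s64]; exact hp _ _ _ (by decide) (by decide) (by decide))
    (hp _ _ _ (by decide) (by decide) (by decide))
    (k 1 none) (hp _ _ _ (by decide) (by decide) (by decide))
    (hp _ _ _ (by decide) (by decide) (by decide))
    (k 2 none) (hp _ _ _ (by decide) (by decide) (by decide))
    (hp _ _ _ (by decide) (by decide) (by decide))
    (k 3 none) (hp _ _ _ (by decide) (by decide) (by decide))
    (hp _ _ _ (by decide) (by decide) (by decide))
  fin_cases j
  exacts [h1, h1.symm, h2, h2.symm]

/-- The number of edges of the Petersen fragment between the classes of `β`. -/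
def petCut (β : Fin 8 → Bool) : ℕ :=
  ∑ i, ∑ j, if β i = true ∧ β j = false ∧ petAdj i (some j) = true then 1 else 0

theorem forall_fin_eight {P : (Fin 8 → Bool) → Prop}
    (h : ∀ b₀ b₁ b₂ b₃ b₄ b₅ b₆ b₇, P ![b₀, b₁, b₂, b₃, b₄, b₅, b₆, b₇]) (β : Fin 8 → Bool) :
    P β := by
  have : β = ![β 0, β 1, β 2, β 3, β 4, β 5, β 6, β 7] := by
    ext i; fin_cases i <;> rfl
  rw [this]; apply h

/-- The number of dangling edges between the classes. -/
def portCut (x : Fin 4 → Bool) (β : Fin 8 → Bool) : ℕ :=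
  ∑ j, if x j = β (port j) then 0 else 1

/-- The number of marked edges between the classes. -/
def markCut (x : Fin 4 → Bool) : ℕ :=
  ∑ j, if x j = true ∧ x (mate j) = false then 1 else 0

theorem markCut_le (x : Fin 4 → Bool) (β : Fin 8 → Bool) :
    markCut x ≤ portCut x β + petCut β ∧ ∀ t : Bool, (∀ i j, x i = t → x j = t → i = j) →
      (∃ i, β i = t) → markCut x + 1 ≤ portCut x β + petCut β := by
  revert x
  revert β
  refine forall_fin_eight ?_
  decide +kernel

theorem three_le_portCut (t : Bool) (β : Fin 8 → Bool) (h : ∃ i, β i ≠ t) :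
    3 ≤ portCut (fun _ ↦ t) β + petCut β ∧ ((∃ i j, i ≠ j ∧ β i ≠ t ∧ β j ≠ t) →
      4 ≤ portCut (fun _ ↦ t) β + petCut β) := by
  revert h
  revert t
  revert β
  refine forall_fin_eight ?_
  decide +kernel

end Petersen

section DotProduct

variable {V : Type}

/-- The edges joining `m j` to `m (mate j)`. -/
def Marked (m : Fin 4 → V) (u v : V) : Prop :=
  ∃ j, u = m j ∧ v = m (mate j)

theorem mate_mate (j : Fin 4) : mate (mate j) = j := by
  revert j; decide

theorem unport_port (j : Fin 4) : unport (port j) = j := by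
  revert j; decide

theorem Marked.symm {m : Fin 4 → V} {u v : V} (h : Marked m u v) : Marked m v u := by
  obtain ⟨j, rfl, rfl⟩ := h
  exact ⟨mate j, rfl, by rw [mate_mate]⟩

theorem IsDartColoring.mono {G : SimpleGraph V} {D D' : V → V → Prop} {S S' : Set V}
    {c : V → V → Fin 3} (h : IsDartColoring G D S c) (hD : ∀ u v, D u v → D' u v) (hS : S ⊆ S') :
    IsDartColoring G D' S' c where
  symm _ _ ha hd := h.symm ha fun h ↦ hd (hD _ _ h)
  proper _ _ _ hu := h.proper fun h ↦ hu (hS h)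

/-- The dot product with the Petersen graph: the marked edges `m j – m (mate j)` are removed, and
the four dangling edges of the Petersen fragment are attached to their ends. -/
def dot (G : SimpleGraph V) (m : Fin 4 → V) : SimpleGraph (V ⊕ Fin 8) where
  Adj
    | .inl u, .inl v => G.Adj u v ∧ ¬ Marked m u v
    | .inl u, .inr i => ∃ j, u = m j ∧ i = port j
    | .inr i, .inl u => ∃ j, u = m j ∧ i = port j
    | .inr i, .inr j => petAdj i (some j) = true
  symm := ⟨by
    rintro (u | i) (v | j) h
    · exact ⟨h.1.symm, fun h' ↦ h.2 h'.symm⟩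
    · exact h
    · exact h
    · exact (petAdj_comm i j).symm.trans h⟩
  loopless := ⟨by
    rintro (u | i) h
    · exact h.1.ne rfl
    · exact absurd h (petAdj_self i)⟩

/-- The vertices of the Petersen fragment that are marked in a dot product. -/
def newMark (j : Fin 4) : V ⊕ Fin 8 := .inr (newPort j)

/-- The neighbour in `G` that corresponds to a neighbour in the dot product. -/
def collapse (m : Fin 4 → V) : V ⊕ Fin 8 → V := Sum.elim id fun i ↦ m (mate (unport i))

/-- The neighbours of a vertex of the Petersen fragment. -/
def petNbr (m : Fin 4 → V) (i : Fin 8) : Option (Fin 8) → V ⊕ Fin 8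
  | none => .inl (m (unport i))
  | some j => .inr j

variable {G : SimpleGraph V} {m : Fin 4 → V}

theorem petNbr_injective (i : Fin 8) : (petNbr m i).Injective := by
  rintro (_ | _) (_ | _) h <;> simp_all [petNbr]

theorem dot_adj_inr {i : Fin 8} {y : V ⊕ Fin 8} :
    (dot G m).Adj (.inr i) y ↔ ∃ x, petAdj i x = true ∧ y = petNbr m i x := by
  have hport : ∀ i : Fin 8, petAdj i none = true → i = port (unport i) := by decide
  have hport' : ∀ j, petAdj (port j) none = true := by decide
  rcases y with u | j
  · constructor
    · rintro ⟨j, rfl, rfl⟩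
      exact ⟨none, hport' j, by rw [petNbr, unport_port]⟩
    · rintro ⟨_ | _, h, h'⟩
      · exact ⟨unport i, Sum.inl_injective h', hport i h⟩
      · simp [petNbr] at h'
  · constructor
    · exact fun h ↦ ⟨some j, h, rfl⟩
    · rintro ⟨_ | _, h, h'⟩
      · simp [petNbr] at h'
      · rw [Sum.inr_injective h']; exact h

/-- The properties needed of the graph to which the dot product with the Petersen graph is
applied; they are preserved by this operation. -/
structure Admissible [Fintype V] (G : SimpleGraph V) (m : Fin 4 → V) : Prop where
  injective : m.Injective
  adj : ∀ j, G.Adj (m j) (m (mate j))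
  cubic : IsCubic G
  wellConnected : WellConnected G
  not_colorable : ¬ ColorableOff G ∅
  critical : ∀ u v, G.Adj u v → ¬ Marked m u v → ColorableOff G {u, v}
  marked : ∀ s, ∃ c, IsDartColoring G (Marked m) {u | ∃ j, exempt s j = true ∧ u = m j} c ∧
    ∀ j, c (m j) (m (mate j)) = pattern s j
  not_bicritical : ∃ u v, u ≠ v ∧ ¬ ColorableOff G {u, v}
  cycle : ∃ f : Fin 5 → V, f.Injective ∧
    ∀ i, G.Adj (f i) (f (i + 1)) ∧ ¬ Marked m (f i) (f (i + 1))

theorem adj_collapse (hadj : ∀ j, G.Adj (m j) (m (mate j))) {u : V} {y : V ⊕ Fin 8}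
    (h : (dot G m).Adj (.inl u) y) : G.Adj u (collapse m y) := by
  rcases y with v | i
  · exact h.1
  · obtain ⟨j, rfl, rfl⟩ := h
    simp only [collapse, Sum.elim_inr, unport_port]
    exact hadj j

theorem collapse_injOn (hm : m.Injective) {u : V} {y z : V ⊕ Fin 8}
    (hy : (dot G m).Adj (.inl u) y) (hz : (dot G m).Adj (.inl u) z)
    (h : collapse m y = collapse m z) : y = z := by
  rcases y with v | i <;> rcases z with w | l
  · exact congrArg _ h
  · obtain ⟨j, rfl, rfl⟩ := hz
    simp only [collapse, Sum.elim_inr, unport_port, Sum.elim_inl, id] at h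
    exact absurd ⟨j, rfl, h⟩ hy.2
  · obtain ⟨j, rfl, rfl⟩ := hy
    simp only [collapse, Sum.elim_inr, unport_port, Sum.elim_inl, id] at h
    exact absurd ⟨j, rfl, h.symm⟩ hz.2
  · obtain ⟨j, rfl, rfl⟩ := hy
    obtain ⟨k, hk, rfl⟩ := hz
    rw [hm hk]

theorem exists_collapse_eq {u v : V} (h : G.Adj u v) :
    ∃ y, (dot G m).Adj (.inl u) y ∧ collapse m y = v := by
  by_cases hM : Marked m u v
  · obtain ⟨j, rfl, rfl⟩ := hM
    exact ⟨.inr (port j), ⟨j, rfl, rfl⟩, by simp [collapse, unport_port]⟩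
  · exact ⟨.inl v, ⟨h, hM⟩, rfl⟩

theorem dot_cubic (hm : m.Injective) (hadj : ∀ j, G.Adj (m j) (m (mate j))) (hG : IsCubic G) :
    IsCubic (dot G m) := by
  rintro (u | i)
  · rw [← hG u]
    have : G.neighborSet u = collapse m '' (dot G m).neighborSet (.inl u) := by
      ext v
      constructor
      · exact fun h ↦ exists_collapse_eq h
      · rintro ⟨y, hy, rfl⟩
        exact adj_collapse hadj hy
    rw [this, Set.InjOn.ncard_image]
    exact fun y hy z hz ↦ collapse_injOn hm hy hz
  · have : (dot G m).neighborSet (.inr i) =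
        petNbr m i '' (Finset.univ.filter fun x ↦ petAdj i x = true : Finset _) := by
      ext y
      simp only [SimpleGraph.mem_neighborSet, dot_adj_inr, Finset.coe_filter, Finset.mem_univ,
        true_and, Set.mem_image, Set.mem_ofPred_eq]
      exact exists_congr fun x ↦ and_congr_right fun _ ↦ eq_comm
    rw [this, Set.ncard_image_of_injective _ (petNbr_injective i), Set.ncard_coe_finset]
    exact petAdj_card i

theorem ColorableOff.of_dot (hm : m.Injective) {S : Set V}
    (h : ColorableOff (dot G m) (.inl '' S)) : ColorableOff G S := by
  obtain ⟨c, hc⟩ := h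
  choose! φ hφ hφ' using fun u v ↦ exists_collapse_eq (G := G) (m := m) (u := u) (v := v)
  have hφ_eq : ∀ {u v y}, G.Adj u v → (dot G m).Adj (.inl u) y → collapse m y = v → φ u v = y :=
    fun ha hy h ↦ collapse_injOn hm (hφ _ _ ha) hy ((hφ' _ _ ha).trans h.symm)
  have hpet : IsPetColoring (fun _ _ ↦ false) (fun _ ↦ false)
      fun i x ↦ c (.inr i) (petNbr m i x) := by
    refine ⟨fun i j ha _ ↦ hc.symm (u := .inr i) (v := .inr j) ha id, ?_⟩
    intro i _ x hx y hy hne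
    exact hc.proper (by simp) (dot_adj_inr.2 ⟨x, hx, rfl⟩) (dot_adj_inr.2 ⟨y, hy, rfl⟩)
      fun h ↦ hne (petNbr_injective i h)
  have hport : ∀ j, (dot G m).Adj (.inl (m j)) (.inr (port j)) := fun j ↦ ⟨j, rfl, rfl⟩
  refine ⟨fun u v ↦ c (.inl u) (φ u v), ?_, ?_⟩
  · intro u v ha _
    by_cases hM : Marked m u v
    · obtain ⟨j, rfl, rfl⟩ := hM
      have h1 := hφ_eq ha (hport j) (by simp [collapse, unport_port])
      have h2 := hφ_eq ha.symm (hport (mate j)) (by simp [collapse, unport_port, mate_mate])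
      have h3 := hpet.mate_eq j
      simp only [petNbr, unport_port] at h3
      rw [h1, h2, hc.symm (hport j) id, h3, hc.symm (hport (mate j)) id]
    · rw [hφ_eq ha (y := .inl v) ⟨ha, hM⟩ rfl,
        hφ_eq ha.symm (y := .inl u) ⟨ha.symm, fun h ↦ hM h.symm⟩ rfl]
      exact hc.symm (u := .inl u) (v := .inl v) ⟨ha, hM⟩ id
  · intro u v w hu hv hw hne
    refine hc.proper (by simpa using hu) (hφ _ _ hv) (hφ _ _ hw) fun h ↦ hne ?_
    rw [← hφ' _ _ hv, ← hφ' _ _ hw, h]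

/-- The colouring of the dot product obtained from colourings of the two parts. -/
def dotColor (m : Fin 4 → V) (c : V → V → Fin 3) (k : Fin 8 → Option (Fin 8) → Fin 3) :
    V ⊕ Fin 8 → V ⊕ Fin 8 → Fin 3
  | .inl u, y => c u (collapse m y)
  | .inr i, .inl _ => k i none
  | .inr i, .inr j => k i (some j)

theorem IsDartColoring.dot (hm : m.Injective) (hadj : ∀ j, G.Adj (m j) (m (mate j)))
    {D : V ⊕ Fin 8 → V ⊕ Fin 8 → Prop} {S : Set V} {S' : Set (V ⊕ Fin 8)} {c : V → V → Fin 3}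
    {E : Fin 8 → Fin 8 → Bool} {T : Fin 8 → Bool} {k : Fin 8 → Option (Fin 8) → Fin 3}
    (hc : IsDartColoring G (Marked m) S c) (hk : IsPetColoring E T k)
    (hck : ∀ j, c (m j) (m (mate j)) = k (port j) none)
    (hE : ∀ i j, E i j = true → D (.inr i) (.inr j))
    (hS : ∀ u ∈ S, .inl u ∈ S') (hT : ∀ i, T i = true → .inr i ∈ S') :
    IsDartColoring (SnarkFamily.dot G m) D S' (dotColor m c k) where
  symm := by
    rintro (u | i) (v | j) ha hd
    · exact hc.symm ha.1 ha.2
    · obtain ⟨l, rfl, rfl⟩ := ha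
      simpa [dotColor, collapse, unport_port] using hck l
    · obtain ⟨l, rfl, rfl⟩ := ha
      simpa [dotColor, collapse, unport_port] using (hck l).symm
    · refine hk.1 i j ha ?_
      by_contra h
      exact hd (hE i j (by simpa using h))
  proper := by
    rintro (u | i) y z hu hy hz hne
    · exact hc.proper (fun h ↦ hu (hS u h)) (adj_collapse hadj hy) (adj_collapse hadj hz)
        fun h ↦ hne (collapse_injOn hm hy hz h)
    · obtain ⟨x, hx, rfl⟩ := dot_adj_inr.1 hy
      obtain ⟨x', hx', rfl⟩ := dot_adj_inr.1 hz
      have hcol : ∀ x, dotColor m c k (.inr i) (petNbr m i x) = k i x := by rintro (_ | _) <;> rfl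
      rw [hcol, hcol]
      refine hk.2 i ?_ x hx x' hx' fun h ↦ hne (by rw [h])
      by_contra h
      exact hu (hT i (by simpa using h))

variable [Fintype V]

theorem Admissible.dot_not_colorable (h : Admissible G m) : ¬ ColorableOff (dot G m) ∅ :=
  fun hc ↦ h.not_colorable (.of_dot h.injective (by simpa using hc))

theorem Admissible.dot_not_bicritical (h : Admissible G m) :
    ∃ u v, u ≠ v ∧ ¬ ColorableOff (dot G m) {u, v} := by
  obtain ⟨p, q, hpq, hnc⟩ := h.not_bicritical
  exact ⟨.inl p, .inl q, by simpa using hpq,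
    fun hc ↦ hnc (.of_dot h.injective (by simpa [Set.image_pair] using hc))⟩

theorem Admissible.dot_marked (h : Admissible G m) (s : Fin 6) :
    ∃ c, IsDartColoring (dot G m) (Marked newMark) {u | ∃ j, exempt s j = true ∧ u = newMark j} c ∧
      ∀ j, c (newMark j) (newMark (mate j)) = pattern s j := by
  obtain ⟨k, hk, hks, f, hf, s', hs', hkf⟩ := exists_petColoring_marked s
  obtain ⟨c, hc, hcs⟩ := h.marked s'
  refine ⟨dotColor m (fun u v ↦ f (c u v)) k, .dot h.injective h.adj (hc.comp hf) hk ?_ ?_ ?_ ?_,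
    hks⟩
  · intro j
    rw [hcs, hkf]
  · intro i j hij
    obtain ⟨l, rfl, rfl⟩ := of_decide_eq_true hij
    exact ⟨l, rfl, rfl⟩
  · simp [hs']
  · intro i hi
    obtain ⟨l, hl, rfl⟩ := of_decide_eq_true hi
    exact ⟨l, hl, rfl⟩

theorem Admissible.dot_critical (h : Admissible G m) (x y : V ⊕ Fin 8)
    (ha : (dot G m).Adj x y) : ColorableOff (dot G m) {x, y} := by
  have hport : ∀ j, ColorableOff (dot G m) {.inl (m j), .inr (port j)} := by
    intro j
    obtain ⟨k, hk, hkj⟩ := exists_petColoring_off_port j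
    obtain ⟨c, hc, hcj⟩ := h.marked ⟨j.val + 2, by omega⟩
    refine ⟨_, .dot h.injective h.adj hc hk ?_ (by simp) ?_ (by simp)⟩
    · intro l
      rw [hcj, hkj]
    · rintro u ⟨l, hl, rfl⟩
      have : l = j := Fin.ext (by simpa [exempt, eq_comm] using hl)
      simp [this]
  rcases x with u | i <;> rcases y with v | j
  · obtain ⟨c, hc⟩ := h.critical u v ha.1 ha.2
    obtain ⟨k, hk, hkb⟩ := exists_petColoring_intact (c (m 0) (m 1)) (c (m 2) (m 3))
    refine ⟨_, .dot h.injective h.adj (hc.mono (by simp) subset_rfl) hk ?_ (by simp) (by simp)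
      (by simp)⟩
    intro j
    rw [hkb]
    have h01 := hc.symm (h.adj 0) id
    have h23 := hc.symm (h.adj 2) id
    fin_cases j
    exacts [rfl, h01.symm, rfl, h23.symm]
  · obtain ⟨l, rfl, rfl⟩ := ha
    exact hport l
  · obtain ⟨l, rfl, rfl⟩ := ha
    rw [Set.pair_comm]
    exact hport l
  · obtain ⟨k, hk, s, hs, hks⟩ := exists_petColoring_off_edge i j ha
    obtain ⟨c, hc, hcs⟩ := h.marked s
    refine ⟨_, .dot h.injective h.adj hc hk ?_ (by simp) (by simp [hs]) (by simp)⟩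
    intro l
    rw [hcs, hks]

theorem Admissible.dot_hasFourCut (h : Admissible G m) : HasFourCut (dot G m) := by
  obtain ⟨f, hf, hf'⟩ := h.cycle
  refine ⟨Sum.isLeft, fun j ↦ .inl (m j), fun j ↦ .inr (port j), fun i ↦ .inl (f i),
    fun i ↦ .inr (![0, 4, 2, 5, 7] i), ?_, Sum.inl_injective.comp hf,
    Sum.inr_injective.comp (by decide), fun i ↦ ⟨rfl, hf' i⟩, fun i ↦ ⟨rfl, ?_⟩⟩
  · rintro (u | i) (v | j) hu hv ha <;> simp at hu hv
    obtain ⟨l, rfl, rfl⟩ := ha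
    exact ⟨l, rfl, rfl⟩
  · change petAdj _ _ = true
    revert i; decide +kernel

theorem sum_le_sum_sum {A B : Type} [Fintype A] [Fintype B] (f : A → B → ℕ) (g : Fin 4 → A)
    (h : Fin 4 → B) (hgh : ∀ i j, g i = g j → h i = h j → i = j) :
    ∑ j, f (g j) (h j) ≤ ∑ a, ∑ b, f a b := by
  rw [← Fintype.sum_prod_type']
  let e : Fin 4 ↪ A × B := ⟨fun j ↦ (g j, h j), fun i j hij ↦
    hgh i j (congrArg Prod.fst hij) (congrArg Prod.snd hij)⟩
  calc ∑ j, f (g j) (h j) = ∑ x ∈ Finset.univ.map e, f x.1 x.2 := by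
        rw [Finset.sum_map]; rfl
    _ ≤ _ := Finset.sum_le_sum_of_subset (Finset.subset_univ _)

open scoped Classical in
/-- The number of unmarked edges between the classes of `α`. -/
noncomputable def innerCut (G : SimpleGraph V) (m : Fin 4 → V) (α : V → Bool) : ℕ :=
  ∑ u, ∑ v, if α u = true ∧ α v = false ∧ G.Adj u v ∧ ¬ Marked m u v then 1 else 0

theorem cutSize_le_innerCut (α : V → Bool) :
    cutSize G α ≤ innerCut G m α + markCut (α ∘ m) := by
  classical
  have h : markCut (α ∘ m) = ∑ u, ∑ v, ∑ j,
      if u = m j then (if v = m (mate j) then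
        (if α (m j) = true ∧ α (m (mate j)) = false then 1 else 0) else 0) else 0 := by
    refine Eq.trans ?_ (Finset.sum_comm.trans (Finset.sum_congr rfl fun u _ ↦ Finset.sum_comm))
    simp [markCut]
  rw [h, innerCut, cutSize, ← Finset.sum_add_distrib]
  refine Finset.sum_le_sum fun u _ ↦ ?_
  rw [← Finset.sum_add_distrib]
  refine Finset.sum_le_sum fun v _ ↦ ?_
  by_cases hM : Marked m u v
  · obtain ⟨j, rfl, rfl⟩ := hM
    refine le_trans ?_ (Nat.le_add_left _ _)
    refine le_trans ?_ (Finset.single_le_sum (fun _ _ ↦ Nat.zero_le _) (Finset.mem_univ j))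
    simp only [if_true]
    split_ifs <;> simp_all
  · refine le_trans ?_ (Nat.le_add_right _ _)
    simp [hM]

theorem le_cutSize_dot (hm : m.Injective) (χ : V ⊕ Fin 8 → Bool) :
    innerCut G m (χ ∘ .inl) + (portCut (χ ∘ .inl ∘ m) (χ ∘ .inr) + petCut (χ ∘ .inr)) ≤
      cutSize (dot G m) χ := by
  classical
  unfold cutSize
  simp only [Fintype.sum_sum_type, Finset.sum_add_distrib]
  have h1 := sum_le_sum_sum (fun (u : V) (i : Fin 8) ↦
    if χ (.inl u) = true ∧ χ (.inr i) = false ∧ (dot G m).Adj (.inl u) (.inr i) then 1 else 0)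
    m port fun i j h _ ↦ hm h
  have h2 := sum_le_sum_sum (fun (i : Fin 8) (u : V) ↦
    if χ (.inr i) = true ∧ χ (.inl u) = false ∧ (dot G m).Adj (.inr i) (.inl u) then 1 else 0)
    port m fun i j _ h ↦ hm h
  have h3 : portCut (χ ∘ .inl ∘ m) (χ ∘ .inr) = (∑ j : Fin 4, if χ (.inl (m j)) = true ∧
        χ (.inr (port j)) = false ∧ (dot G m).Adj (.inl (m j)) (.inr (port j)) then 1 else 0) +
      ∑ j : Fin 4, if χ (.inr (port j)) = true ∧ χ (.inl (m j)) = false ∧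
        (dot G m).Adj (.inr (port j)) (.inl (m j)) then 1 else 0 := by
    rw [← Finset.sum_add_distrib, portCut]
    refine Finset.sum_congr rfl fun j _ ↦ ?_
    have hj : (dot G m).Adj (.inl (m j)) (.inr (port j)) := ⟨j, rfl, rfl⟩
    simp only [hj, hj.symm, and_true, Function.comp_apply]
    rcases Bool.eq_false_or_eq_true (χ (.inl (m j))) with hl | hl <;>
      rcases Bool.eq_false_or_eq_true (χ (.inr (port j))) with hr | hr <;> simp [hl, hr]
  have h4 : innerCut G m (χ ∘ .inl) = ∑ u, ∑ v, if χ (.inl u) = true ∧ χ (.inl v) = false ∧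
      (dot G m).Adj (.inl u) (.inl v) then 1 else 0 := by
    unfold innerCut
    congr!
  have h5 : petCut (χ ∘ .inr) = ∑ i, ∑ j, if χ (.inr i) = true ∧ χ (.inr j) = false ∧
      (dot G m).Adj (.inr i) (.inr j) then 1 else 0 := by
    unfold petCut
    congr!
  omega

theorem Admissible.dot_wellConnected (h : Admissible G m) : WellConnected (dot G m) := by
  classical
  rintro χ ⟨x, hx⟩ ⟨y, hy⟩
  have hle := le_cutSize_dot (G := G) h.injective χ
  have hG := cutSize_le_innerCut (G := G) (m := m) (χ ∘ .inl)
  obtain ⟨hmark, hmark'⟩ := markCut_le (χ ∘ .inl ∘ m) (χ ∘ .inr)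
  have hassoc : (χ ∘ .inl) ∘ m = χ ∘ .inl ∘ m := rfl
  rw [hassoc] at hG
  by_cases hconst : ∃ t, ∀ u, χ (.inl u) = t
  · obtain ⟨t, ht⟩ := hconst
    have hfun : χ ∘ .inl ∘ m = fun _ ↦ t := funext fun j ↦ ht (m j)
    have hinr : ∀ z, χ z ≠ t → ∃ i, z = .inr i := by
      rintro (u | i) hz
      · exact absurd (ht u) hz
      · exact ⟨i, rfl⟩
    have hz : ∃ z, χ z ≠ t := by
      cases t
      exacts [⟨x, by simp [hx]⟩, ⟨y, by simp [hy]⟩]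
    obtain ⟨z, hz⟩ := hz
    obtain ⟨i, rfl⟩ := hinr z hz
    obtain ⟨h3, h4⟩ := three_le_portCut t (χ ∘ .inr) ⟨i, hz⟩
    rw [hfun] at hle
    refine ⟨by omega, fun hT hF ↦ ?_⟩
    have htwo : ∃ z w, z ≠ w ∧ χ z ≠ t ∧ χ w ≠ t := by
      cases t
      · simpa using hT
      · simpa using hF
    obtain ⟨z, w, hzw, hz, hw⟩ := htwo
    obtain ⟨i, rfl⟩ := hinr z hz
    obtain ⟨j, rfl⟩ := hinr w hw
    have := h4 ⟨i, j, fun hij ↦ hzw (congrArg _ hij), hz, hw⟩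
    omega
  · have hex : ∀ t, ∃ u, χ (.inl u) = t := by
      intro t
      by_contra! hne
      exact hconst ⟨!t, fun u ↦ Bool.eq_not.2 (hne u)⟩
    obtain ⟨h3, h4⟩ := h.wellConnected (χ ∘ .inl) (hex true) (hex false)
    refine ⟨by omega, fun hT hF ↦ ?_⟩
    have hone : ∀ t, (∃ z w, z ≠ w ∧ χ z = t ∧ χ w = t) →
        ¬ (∃ u v, u ≠ v ∧ χ (.inl u) = t ∧ χ (.inl v) = t) → 4 ≤ cutSize (dot G m) χ := by
      rintro t ⟨z, w, hzw, hz, hw⟩ hnot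
      have huniq : ∀ u v, χ (.inl u) = t → χ (.inl v) = t → u = v := by
        intro u v hu hv
        by_contra hne
        exact hnot ⟨u, v, hne, hu, hv⟩
      have := hmark' t (fun i j hi hj ↦ h.injective (huniq _ _ hi hj)) (by
        rcases z with u | i
        · rcases w with v | j
          · exact absurd (congrArg _ (huniq u v hz hw)) hzw
          · exact ⟨j, hw⟩
        · exact ⟨i, hz⟩)
      omega
    by_cases hT' : ∃ u v, u ≠ v ∧ χ (.inl u) = true ∧ χ (.inl v) = true
    · by_cases hF' : ∃ u v, u ≠ v ∧ χ (.inl u) = false ∧ χ (.inl v) = false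
      · have := h4 hT' hF'
        omega
      · exact hone false hF hF'
    · exact hone true hT hT'

theorem Admissible.dot_isGood (h : Admissible G m) : IsGood (dot G m) where
  cubic := dot_cubic h.injective h.adj h.cubic
  wellConnected := h.dot_wellConnected
  not_colorable := h.dot_not_colorable
  critical := h.dot_critical
  not_bicritical := h.dot_not_bicritical
  fourCut := h.dot_hasFourCut

theorem Admissible.dot (h : Admissible G m) : Admissible (SnarkFamily.dot G m) newMark where
  injective := Sum.inr_injective.comp (by decide)
  adj := by
    intro j
    change petAdj (newPort j) (some (newPort (mate j))) = true
    revert j; decide +kernel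
  cubic := dot_cubic h.injective h.adj h.cubic
  wellConnected := h.dot_wellConnected
  not_colorable := h.dot_not_colorable
  critical _ _ ha _ := h.dot_critical _ _ ha
  marked := h.dot_marked
  not_bicritical := h.dot_not_bicritical
  cycle := by
    obtain ⟨f, hf, hf'⟩ := h.cycle
    refine ⟨fun i ↦ .inl (f i), Sum.inl_injective.comp hf, fun i ↦ ⟨hf' i, ?_⟩⟩
    rintro ⟨j, hj, -⟩
    exact Sum.inl_ne_inr hj

end DotProduct

section Table

variable {V : Type}

/-- The functions listing the three neighbours of every vertex of a cubic graph. -/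
def IsTable (nbr : V → Fin 3 → V) : Prop :=
  (∀ u s, ∃ t, nbr (nbr u s) t = u) ∧ (∀ u s, nbr u s ≠ u) ∧
    ∀ u s t, s ≠ t → nbr u s ≠ nbr u t

instance [Fintype V] [DecidableEq V] (nbr : V → Fin 3 → V) : Decidable (IsTable nbr) := by
  unfold IsTable; infer_instance

/-- The cubic graph with given neighbours. -/
def ofTable (nbr : V → Fin 3 → V) (h : IsTable nbr) : SimpleGraph V where
  Adj u v := ∃ s, nbr u s = v
  symm := ⟨by rintro u _ ⟨s, rfl⟩; exact h.1 u s⟩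
  loopless := ⟨by rintro u ⟨s, hs⟩; exact h.2.1 u s hs⟩

/-- Assignments of colours to the halves of the edges of a table that are proper outside `S` and
agree on edges outside `D`. -/
def IsTableColoring (nbr : V → Fin 3 → V) (D : V → V → Prop) (S : V → Prop)
    (col : V → Fin 3 → Fin 3) : Prop :=
  (∀ u, S u ∨ ∀ s t, s ≠ t → col u s ≠ col u t) ∧
    ∀ u s, D u (nbr u s) ∨ ∃ t, nbr (nbr u s) t = u ∧ col u s = col (nbr u s) t

instance [Fintype V] [DecidableEq V] (nbr : V → Fin 3 → V) (D : V → V → Prop)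
    [∀ u v, Decidable (D u v)] (S : V → Prop) [DecidablePred S] (col : V → Fin 3 → Fin 3) :
    Decidable (IsTableColoring nbr D S col) := by
  unfold IsTableColoring; infer_instance

instance [DecidableEq V] (m : Fin 4 → V) (u v : V) : Decidable (Marked m u v) := by
  unfold Marked; infer_instance

variable {nbr : V → Fin 3 → V}

theorem IsTable.injective (hT : IsTable nbr) (u : V) : (nbr u).Injective := by
  intro s t h
  by_contra hne
  exact hT.2.2 u s t hne h

theorem IsTable.isCubic (hT : IsTable nbr) : IsCubic (ofTable nbr hT) := by
  intro u
  have : (ofTable nbr hT).neighborSet u = nbr u '' Set.univ := by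
    ext v; simp [ofTable]
  rw [this, Set.ncard_image_of_injective _ (hT.injective u), Set.ncard_univ]
  simp

theorem IsTableColoring.exists_isDartColoring (hT : IsTable nbr) {D : V → V → Prop} {S : V → Prop}
    {col : V → Fin 3 → Fin 3} (h : IsTableColoring nbr D S col) :
    ∃ c, IsDartColoring (ofTable nbr hT) D {u | S u} c ∧ ∀ u s, c u (nbr u s) = col u s := by
  classical
  let c : V → V → Fin 3 := fun u v ↦ if hv : ∃ s, nbr u s = v then col u hv.choose else 0
  have hc : ∀ u s, c u (nbr u s) = col u s := by
    intro u s
    have hv : ∃ t, nbr u t = nbr u s := ⟨s, rfl⟩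
    simp only [c, dif_pos hv]
    rw [hT.injective u hv.choose_spec]
  refine ⟨c, ⟨?_, ?_⟩, hc⟩
  · rintro u _ ⟨s, rfl⟩ hD
    obtain ⟨t, ht, hcol⟩ := (h.2 u s).resolve_left hD
    have := hc (nbr u s) t
    rw [ht] at this
    rw [hc, this, hcol]
  · rintro u _ _ hu ⟨s, rfl⟩ ⟨t, rfl⟩ hne
    rw [hc, hc]
    exact (h.1 u).resolve_left hu s t fun h ↦ hne (by rw [h])

end Table

section Search

/-- Search for an extension of a partial edge colouring. Edges are given by the bit masks of their
ends, and `x`, `y`, `z` are the masks of the vertices where each colour is used. -/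
def colorSearch : List ℕ → ℕ → ℕ → ℕ → Bool
  | [], _, _, _ => true
  | e :: l, x, y, z =>
    (Nat.beq (Nat.land x e) 0 && colorSearch l (Nat.lor x e) y z) ||
    (Nat.beq (Nat.land y e) 0 && colorSearch l x (Nat.lor y e) z) ||
    (Nat.beq (Nat.land z e) 0 && colorSearch l x y (Nat.lor z e))

theorem colorSearch_eq_true {ι : Type} (mask : ι → ℕ) (col : ι → Fin 3) (l : List ι)
    (hl : l.Pairwise fun e e' ↦ col e = col e' → mask e &&& mask e' = 0) (x : Fin 3 → ℕ)
    (hx : ∀ e ∈ l, x (col e) &&& mask e = 0) :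
    colorSearch (l.map mask) (x 0) (x 1) (x 2) = true := by
  induction l generalizing x with
  | nil => rfl
  | cons e l ih =>
    rw [List.pairwise_cons] at hl
    have h0 : Nat.land (x (col e)) (mask e) = 0 := hx e (by simp)
    have hstep := ih hl.2 (Function.update x (col e) (x (col e) ||| mask e)) (by
      intro e' he'
      have h1 := hx e' (by simp [he'])
      by_cases hcol : col e = col e'
      · rw [← hcol, Function.update_self, Nat.and_or_distrib_right, hcol, h1, hl.1 e' he' hcol]
        rfl
      · rw [Function.update_of_ne (Ne.symm hcol)]
        exact h1)
    simp only [List.map_cons, colorSearch, Bool.or_eq_true, Bool.and_eq_true]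
    generalize col e = i at h0 hstep
    fin_cases i
    · exact .inl (.inl ⟨by simp only [Fin.zero_eta] at h0; rw [h0]; rfl, hstep⟩)
    · exact .inl (.inr ⟨by simp only [Fin.mk_one] at h0; rw [h0]; rfl, hstep⟩)
    · exact .inr ⟨by simp only [Fin.reduceFinMk] at h0; rw [h0]; rfl, hstep⟩

/-- The bit mask of the ends of an edge outside `S`. -/
def edgeMask {n : ℕ} (S : Fin n → Bool) (e : Fin n × Fin n) : ℕ :=
  (if S e.1 then 0 else 2 ^ e.1.val) ||| (if S e.2 then 0 else 2 ^ e.2.val)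

/-- Whether distinct edges are disjoint outside `S`, or meet in a vertex outside `S`. -/
def edgesCompatible {n : ℕ} (S : Fin n → Bool) (e e' : Fin n × Fin n) : Bool :=
  Nat.beq (Nat.land (edgeMask S e) (edgeMask S e')) 0 ||
  (!S e.1 && ((e.1 == e'.1 && e.2 != e'.2) || (e.1 == e'.2 && e.2 != e'.1))) ||
  (!S e.2 && ((e.2 == e'.1 && e.1 != e'.2) || (e.2 == e'.2 && e.1 != e'.1)))

theorem not_colorableOff_of_search {n : ℕ} {G : SimpleGraph (Fin n)} (S : Fin n → Bool)
    (l : List (Fin n × Fin n)) (hadj : ∀ e ∈ l, G.Adj e.1 e.2)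
    (hl : l.Pairwise fun e e' ↦ edgesCompatible S e e' = true)
    (hs : colorSearch (l.map (edgeMask S)) 0 0 0 = false) :
    ¬ ColorableOff G {u | S u = true} := by
  rintro ⟨c, hc⟩
  have h := colorSearch_eq_true (edgeMask S) (fun e ↦ c e.1 e.2) l ?_ (fun _ ↦ 0) (by simp)
  · rw [hs] at h
    exact Bool.false_ne_true h
  · have hl' : l.Pairwise fun e e' ↦ G.Adj e.1 e.2 ∧ G.Adj e'.1 e'.2 :=
      List.Pairwise.imp_of_mem (R := fun _ _ ↦ True)
        (fun ha hb _ ↦ ⟨hadj _ ha, hadj _ hb⟩) (List.pairwise_of_forall fun _ _ ↦ trivial)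
    refine (hl.and hl').imp ?_
    rintro ⟨u, v⟩ ⟨u', v'⟩ ⟨h, ha, ha'⟩ heq
    simp only [edgesCompatible, Bool.or_eq_true, Bool.and_eq_true, Bool.not_eq_true', bne_iff_ne,
      beq_iff_eq] at h ha ha' heq
    have hS : ∀ w, S w = false → w ∉ {u | S u = true} := fun w hw ↦ by simp [hw]
    rcases h with (h | ⟨hw, ⟨rfl, hne⟩ | ⟨rfl, hne⟩⟩) | ⟨hw, ⟨rfl, hne⟩ | ⟨rfl, hne⟩⟩
    · exact Nat.eq_of_beq_eq_true h
    · exact absurd heq (hc.proper (hS _ hw) ha ha' hne)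
    · rw [hc.symm ha' id] at heq
      exact absurd heq (hc.proper (hS _ hw) ha ha'.symm hne)
    · rw [hc.symm ha id] at heq
      exact absurd heq (hc.proper (hS _ hw) ha.symm ha' hne)
    · rw [hc.symm ha id, hc.symm ha' id] at heq
      exact absurd heq (hc.proper (hS _ hw) ha.symm ha'.symm hne)

/-- Verify that all cuts have at least three edges, and at least four unless one side has at most
one vertex. The list contains the smaller neighbours of the vertices from `i` on; `x` is the bit
mask of one side among the vertices below `i`, `cut` is the size of the cut so far, and `t` and `f` are
the numbers of vertices on its sides. -/
def cutSearch : List (List ℕ) → ℕ → ℕ → ℕ → ℕ → ℕ → Bool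
  | [], _, _, cut, t, f =>
    Nat.ble 4 cut || Nat.beq t 0 || Nat.beq f 0 || (Nat.ble 3 cut && (Nat.ble t 1 || Nat.ble f 1))
  | r :: l, i, x, cut, t, f =>
    Nat.ble 4 cut ||
    (cutSearch l (i + 1) (x ||| 2 ^ i) (cut + r.countP fun j ↦ x.testBit j != true) (t + 1) f &&
      cutSearch l (i + 1) x (cut + r.countP fun j ↦ x.testBit j != false) t (f + 1))

theorem cutSearch_sound (χ : ℕ → Bool) (l : List (List ℕ)) (i x cut t f : ℕ)
    (hx : ∀ j, x.testBit j = (decide (j < i) && χ j))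
    (hl : ∀ k, ∀ j ∈ l.getD k [], j < i + k) (h : cutSearch l i x cut t f = true) :
    4 ≤ cut + ∑ k ∈ Finset.range l.length, (l.getD k []).countP (fun j ↦ χ j != χ (i + k)) ∨
    t + ∑ k ∈ Finset.range l.length, (χ (i + k)).toNat = 0 ∨
    f + ∑ k ∈ Finset.range l.length, (!χ (i + k)).toNat = 0 ∨
    (3 ≤ cut + ∑ k ∈ Finset.range l.length, (l.getD k []).countP (fun j ↦ χ j != χ (i + k)) ∧
      (t + ∑ k ∈ Finset.range l.length, (χ (i + k)).toNat ≤ 1 ∨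
        f + ∑ k ∈ Finset.range l.length, (!χ (i + k)).toNat ≤ 1)) := by
  induction l generalizing i x cut t f with
  | nil =>
    simp only [cutSearch, Bool.or_eq_true, Bool.and_eq_true, Nat.ble_eq, Nat.beq_eq] at h
    simp only [List.length_nil, Finset.range_zero, Finset.sum_empty, add_zero]
    tauto
  | cons r l ih =>
    simp only [cutSearch, Bool.or_eq_true, Bool.and_eq_true, Nat.ble_eq] at h
    rcases h with h | ⟨ht, hf⟩
    · exact .inl (h.trans (Nat.le_add_right _ _))
    have hcount : ∀ b, r.countP (fun j ↦ x.testBit j != b) = r.countP fun j ↦ χ j != b := by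
      intro b
      refine List.countP_congr fun j hj ↦ ?_
      have : j < i := hl 0 j hj
      simp [hx, this]
    have hl' : ∀ k, ∀ j ∈ l.getD k [], j < i + 1 + k := by
      intro k j hj
      have := hl (k + 1) j hj
      omega
    have hadd : ∀ k, i + 1 + k = i + (k + 1) := fun k ↦ by omega
    simp only [List.length_cons, Finset.sum_range_succ', List.getD_cons_succ, List.getD_cons_zero,
      add_zero]
    have hlt : ∀ j, decide (j < i + 1) = (decide (j < i) || decide (i = j)) := by
      intro j
      rw [← Bool.decide_or]
      exact decide_eq_decide.2 (by omega)
    cases hi : χ i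
    · have := ih (i + 1) x _ t (f + 1) (by
        intro j
        rw [hx, hlt]
        by_cases hij : i = j
        · subst hij; simp [hi]
        · simp [hij]) hl' hf
      rw [hcount] at this
      simp only [hadd] at this
      simp only [Bool.toNat_false, Bool.not_false, Bool.toNat_true, add_zero]
      omega
    · have := ih (i + 1) (x ||| 2 ^ i) _ (t + 1) f (by
        intro j
        rw [Nat.testBit_or, hx, Nat.testBit_two_pow, hlt]
        by_cases hij : i = j
        · subst hij; simp [hi]
        · simp [hij]) hl' ht
      rw [hcount] at this
      simp only [hadd] at this
      simp only [Bool.toNat_false, Bool.not_true, Bool.toNat_true, add_zero]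
      omega

theorem sum_backward_le_cutSize {n : ℕ} (G : SimpleGraph (Fin n)) (χ : Fin n → Bool)
    (b : Fin n → ℕ) (hb : ∀ u, ∃ s : Finset (Fin n), b u = s.card ∧
      ∀ v ∈ s, v < u ∧ G.Adj u v ∧ χ u ≠ χ v) : ∑ u, b u ≤ cutSize G χ := by
  classical
  choose s hs hs' using hb
  let g : Fin n → Fin n → ℕ := fun u v ↦ if χ u = true ∧ χ v = false ∧ G.Adj u v then 1 else 0
  have h1 : ∑ u, b u ≤ ∑ u, ∑ v, ((if v < u then g u v else 0) + if v < u then g v u else 0) := by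
    refine Finset.sum_le_sum fun u _ ↦ ?_
    rw [hs, Finset.card_eq_sum_ones]
    refine (Finset.sum_le_sum fun v hv ↦ ?_).trans
      (Finset.sum_le_sum_of_subset (Finset.subset_univ (s u)))
    obtain ⟨hlt, ha, hne⟩ := hs' u v hv
    simp only [g, hlt, if_true, ha, ha.symm, and_true]
    rcases Bool.eq_false_or_eq_true (χ u) with hu | hu <;>
      rcases Bool.eq_false_or_eq_true (χ v) with hv | hv <;> simp_all
  have h2 : ∑ u, ∑ v, (if v < u then g v u else 0) = ∑ u, ∑ v, if u < v then g u v else 0 :=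
    Finset.sum_comm
  have h3 : cutSize G χ = ∑ u, ∑ v, g u v := by
    unfold cutSize
    congr!
  simp only [Finset.sum_add_distrib] at h1
  rw [h2, ← Finset.sum_add_distrib] at h1
  rw [h3]
  refine h1.trans (Finset.sum_le_sum fun u _ ↦ ?_)
  rw [← Finset.sum_add_distrib]
  refine Finset.sum_le_sum fun v _ ↦ ?_
  by_cases h : v < u
  · simp [h, h.not_gt]
  · simp only [h, if_false, zero_add]
    split_ifs <;> simp

theorem wellConnected_of_search {n : ℕ} {G : SimpleGraph (Fin n)} (l : List (List ℕ))
    (hlen : l.length = n)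
    (hl : ∀ u : Fin n, (l.getD u.val []).Nodup ∧
      ∀ j ∈ l.getD u.val [], j < u.val ∧ ∃ v : Fin n, v.val = j ∧ G.Adj u v)
    (h : cutSearch l 0 0 0 0 0 = true) : WellConnected G := by
  classical
  intro χ hT hF
  let χ' : ℕ → Bool := fun j ↦ if hj : j < n then χ ⟨j, hj⟩ else false
  have hχ : ∀ u : Fin n, χ' u.val = χ u := fun u ↦ by simp [χ']
  have hsound := cutSearch_sound χ' l 0 0 0 0 0 (by simp) (by
    intro k j hj
    by_cases hk : k < n
    · simpa using ((hl ⟨k, hk⟩).2 j hj).1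
    · rw [List.getD_eq_default _ _ (by omega)] at hj
      simp at hj) h
  simp only [zero_add, hlen] at hsound
  rw [Finset.sum_range, Finset.sum_range, Finset.sum_range] at hsound
  simp only [hχ] at hsound
  have hcut : ∑ u : Fin n, (l.getD u.val []).countP (fun j ↦ χ' j != χ u) ≤ cutSize G χ := by
    refine sum_backward_le_cutSize G χ _ fun u ↦
      ⟨Finset.univ.filter fun v ↦ v.val ∈ l.getD u.val [] ∧ χ u ≠ χ v, ?_, ?_⟩
    · rw [List.countP_eq_length_filter, ← List.toFinset_card_of_nodup ((hl u).1.filter _)]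
      symm
      refine Finset.card_bij (fun v _ ↦ v.val) ?_ ?_ ?_
      · intro v hv
        simp only [Finset.mem_filter, Finset.mem_univ, true_and] at hv
        simp only [List.mem_toFinset, List.mem_filter, hχ, bne_iff_ne]
        exact ⟨hv.1, hv.2.symm⟩
      · exact fun v _ w _ hvw ↦ Fin.ext hvw
      · intro j hj
        simp only [List.mem_toFinset, List.mem_filter, bne_iff_ne] at hj
        obtain ⟨-, v, rfl, -⟩ := (hl u).2 j hj.1
        rw [hχ] at hj
        exact ⟨v, by simpa using ⟨hj.1, hj.2.symm⟩, rfl⟩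
    · intro v hv
      simp only [Finset.mem_filter, Finset.mem_univ, true_and] at hv
      obtain ⟨hlt, w, hw, ha⟩ := (hl u).2 v.val hv.1
      rw [Fin.ext hw] at ha
      exact ⟨hlt, ha, hv.2⟩
  have hcount : ∀ χ : Fin n → Bool,
      ∑ u, (χ u).toNat = (Finset.univ.filter fun u ↦ χ u = true).card := by
    intro χ
    rw [Finset.card_filter]
    exact Finset.sum_congr rfl fun u _ ↦ by cases χ u <;> rfl
  have hone : ∀ χ : Fin n → Bool, (∃ u, χ u = true) → 1 ≤ ∑ u, (χ u).toNat := by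
    rintro χ ⟨u, hu⟩
    rw [hcount]
    exact Finset.card_pos.2 ⟨u, by simpa using hu⟩
  have htwo : ∀ χ : Fin n → Bool, (∃ u v, u ≠ v ∧ χ u = true ∧ χ v = true) →
      2 ≤ ∑ u, (χ u).toNat := by
    rintro χ ⟨u, v, hne, hu, hv⟩
    rw [hcount]
    exact Finset.one_lt_card.2 ⟨u, by simpa using hu, v, by simpa using hv, hne⟩
  have hT' := hone χ hT
  have hF' := hone (fun u ↦ !χ u) (by simpa using hF)
  refine ⟨by omega, fun hT hF ↦ ?_⟩
  have hT' := htwo χ hT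
  have hF' := htwo (fun u ↦ !χ u) (by simpa using hF)
  omega

end Search

section Base

variable {n : ℕ}

/-- Read the neighbours of a vertex off the base 32 digits of a number. -/
def tableNbr (n N : ℕ) [NeZero n] (u : Fin n) (s : Fin 3) : Fin n :=
  Fin.ofNat n (N / 32 ^ (3 * u.val + s.val) % 32)

/-- Read the colours around a vertex off the base 4 digits of a number. -/
def tableColor (N : ℕ) (u : Fin n) (s : Fin 3) : Fin 3 :=
  Fin.ofNat 3 (N / 4 ^ (3 * u.val + s.val) % 4)

theorem admissible_of_table {nbr : Fin n → Fin 3 → Fin n} (hT : IsTable nbr) (m : Fin 4 → Fin n)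
    (hinj : ∀ i j, m i = m j → i = j) (hadj : ∀ j, ∃ s, nbr (m j) s = m (mate j))
    (rows : List (List ℕ)) (hlen : rows.length = n)
    (hrows : ∀ u : Fin n, (rows.getD u.val []).Nodup ∧
      ∀ j ∈ rows.getD u.val [], j < u.val ∧ ∃ s, (nbr u s).val = j)
    (hcut : cutSearch rows 0 0 0 0 0 = true)
    (l : List (Fin n × Fin n)) (hl : ∀ e ∈ l, ∃ s, nbr e.1 s = e.2)
    (hpair : l.Pairwise fun e e' ↦ edgesCompatible (fun _ ↦ false) e e' = true)
    (hsearch : colorSearch (l.map (edgeMask fun _ ↦ false)) 0 0 0 = false)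
    (l' : List (Fin n × Fin n)) (hl' : ∀ e ∈ l', ∃ s, nbr e.1 s = e.2)
    (hpair' : l'.Pairwise fun e e' ↦
      edgesCompatible (fun u ↦ u == m 0 || u == m 1) e e' = true)
    (hsearch' : colorSearch (l'.map (edgeMask fun u ↦ u == m 0 || u == m 1)) 0 0 0 = false)
    (certs : List (Fin n × Fin n × ℕ))
    (hcerts : ∀ e ∈ certs, IsTableColoring nbr (fun _ _ ↦ False) (fun w ↦ w = e.1 ∨ w = e.2.1)
      (tableColor e.2.2))
    (hcover : ∀ u s, Marked m u (nbr u s) ∨ ∃ e ∈ certs,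
      (u = e.1 ∧ nbr u s = e.2.1) ∨ (u = e.2.1 ∧ nbr u s = e.1))
    (marks : Fin 6 → ℕ)
    (hmarks : ∀ s, IsTableColoring nbr (Marked m) (fun u ↦ ∃ j, exempt s j = true ∧ u = m j)
      (tableColor (marks s)))
    (hpattern : ∀ s j, ∃ t, nbr (m j) t = m (mate j) ∧ tableColor (marks s) (m j) t = pattern s j)
    (f : Fin 5 → Fin n) (hf : ∀ i j, f i = f j → i = j)
    (hcycle : ∀ i, (∃ s, nbr (f i) s = f (i + 1)) ∧ ¬ Marked m (f i) (f (i + 1))) :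
    Admissible (ofTable nbr hT) m where
  injective _ _ h := hinj _ _ h
  adj := hadj
  cubic := IsTable.isCubic hT
  wellConnected := wellConnected_of_search rows hlen (fun u ↦ ⟨(hrows u).1, fun j hj ↦
    ⟨((hrows u).2 j hj).1, by
      obtain ⟨-, s, hs⟩ := (hrows u).2 j hj
      exact ⟨nbr u s, hs, s, rfl⟩⟩⟩) hcut
  not_colorable := by
    have := not_colorableOff_of_search (G := ofTable nbr hT) _ l hl hpair hsearch
    simpa using this
  critical := by
    rintro u _ ⟨s, rfl⟩ hM
    obtain ⟨⟨a, b, N⟩, he, huv⟩ := (hcover u s).resolve_left hM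
    obtain ⟨c, hc, -⟩ := (hcerts _ he).exists_isDartColoring hT
    refine ⟨c, ?_⟩
    have hab : ({u, nbr u s} : Set (Fin n)) = {w | w = a ∨ w = b} := by
      ext w
      rcases huv with ⟨h1, h2⟩ | ⟨h1, h2⟩
      · simp only [h2, Set.mem_insert_iff, Set.mem_singleton_iff, Set.mem_ofPred_eq]
        rw [h1]
      · simp only [h2, Set.mem_insert_iff, Set.mem_singleton_iff, Set.mem_ofPred_eq]
        rw [h1, or_comm]
    rw [hab]
    exact hc
  marked s := by
    obtain ⟨c, hc, hcol⟩ := (hmarks s).exists_isDartColoring hT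
    refine ⟨c, hc, fun j ↦ ?_⟩
    obtain ⟨t, ht, hp⟩ := hpattern s j
    rw [← hp, ← hcol, ht]
  not_bicritical := by
    refine ⟨m 0, m 1, fun h ↦ absurd (hinj _ _ h) (by decide), ?_⟩
    have := not_colorableOff_of_search (G := ofTable nbr hT) _ l' hl' hpair' hsearch'
    convert this using 2
    ext w
    simp
  cycle := ⟨f, fun _ _ h ↦ hf _ _ h, hcycle⟩

/-- The neighbours in a graph with 24 vertices. -/
def neighborsOnTwentyFour : Fin 24 → Fin 3 → Fin 24 :=
  tableNbr 24
    1664057868311810719105776617628498249413960063796539291359105076172118097677474255747983428194673678894513217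

theorem isTable_neighborsOnTwentyFour : IsTable neighborsOnTwentyFour := by
  decide +kernel

theorem admissible_onTwentyFour :
    Admissible (ofTable _ isTable_neighborsOnTwentyFour) ![7, 8, 2, 5] :=
  admissible_of_table isTable_neighborsOnTwentyFour ![7, 8, 2, 5]
    (by decide +kernel) (by decide +kernel)
    [[], [0], [0], [1], [2, 3], [2], [1, 5], [4], [6, 7], [3], [5], [9], [10, 11], [11], [10, 13],
      [0, 13], [9, 14], [8], [12, 17], [18], [7, 19], [15, 19], [16, 20], [17, 21, 22]]
    rfl (by decide +kernel) (by decide +kernel)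
    [(12, 11), (12, 18), (12, 10), (13, 11), (9, 11), (13, 14), (13, 15), (10, 14), (5, 10),
      (14, 16), (9, 16), (9, 3), (22, 16), (21, 15), (15, 0), (23, 21), (21, 19), (18, 19),
      (18, 17), (19, 20), (23, 22), (23, 17), (22, 20), (17, 8), (7, 20), (7, 8), (7, 4), (6, 8),
      (4, 3), (2, 4), (1, 3), (5, 6), (2, 5), (6, 1), (2, 0), (1, 0)]
    (by decide +kernel) (by decide +kernel) (by decide +kernel)
    [(1, 0), (15, 0), (2, 0), (2, 5), (2, 4), (6, 1), (1, 3), (4, 3), (7, 4), (9, 3), (5, 6),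
      (5, 10), (6, 8), (9, 16), (9, 11), (13, 15), (21, 15), (13, 11), (13, 14), (12, 11),
      (14, 16), (10, 14), (12, 10), (12, 18), (22, 16), (18, 17), (18, 19), (21, 19), (23, 21),
      (19, 20), (23, 22), (22, 20), (23, 17), (17, 8), (7, 20)]
    (by decide +kernel) (by decide +kernel) (by decide +kernel)
    [(0, 1, 8496303196410291636010147125196044448188928),
      (0, 2, 12741735184400505012887592636428575689836800),
      (0, 15, 8463855775917112469072800990311191845161216),
      (1, 3, 2125428281286814938216870544006999252799524),
      (1, 6, 3171548824624704198724020280157956903931940),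
      (2, 4, 3188149744853324010882653979011648449747236),
      (3, 4, 3187898271531886302859055342413924951955748),
      (3, 9, 8463855775917357816941113996199137811765540),
      (4, 7, 3171548824624704198724020279288380040550692),
      (5, 6, 12725888684135715115666143996717108337973540),
      (5, 10, 11695614639084835522713782136194682948196644),
      (6, 8, 6370860269276552424797651737494191950043428),
      (7, 20, 12742240845950143116922638764344219420465444),
      (8, 17, 12742238129050388274168604620116140419848484),
      (9, 11, 3171796252822608470097808535545677626087716),
      (9, 16, 12725888683147106276143760182989151415965988),
      (10, 12, 12725888683146947647563681778575097513515300),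
      (10, 14, 12725888683146947471633675511639485912062244),
      (11, 12, 11695614639084597607008340356921465491560740),
      (11, 13, 11695614639084597488239965539150460872956196),
      (12, 18, 12742238129729848995735094035908672975411492),
      (13, 14, 11695614639084835482212591724311822954010916),
      (13, 15, 11695359120639393384163366514307589598484772),
      (14, 16, 3171796252822449860841377077873106294806820),
      (15, 21, 11678498943511529107715531789538555882510628),
      (16, 22, 3138857733854764312665607439754242361268516),
      (17, 18, 3187898271851334195224621629776142732237092),
      (17, 23, 7101741599511529102806794811502099685579044),
      (18, 19, 8496558690531813542551557678969723847842084),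
      (19, 20, 6370852261116992047447368839125725125941540),
      (19, 21, 6402800978047310551661079844421205961873700),
      (20, 22, 2092737247956103872363246925051848575818020),
      (21, 23, 12043305624469586839596744548013413738354980),
      (22, 23, 3514553450555880783456697002757165477665060)]
    (by decide +kernel) (by decide +kernel)
    ![11679265194154712523430469660230546270754340, 11679265194154712523430469660230755650470497,
      12741735184400505012887592636389202450224262, 3187898271531886302859055341866021074540068,
      11695614641062139862083778584222497352753737, 6370608795955118435126536030824760475009426]
    (by decide +kernel) (by decide +kernel)
    ![0, 1, 3, 4, 2] (by decide +kernel) (by decide +kernel)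

/-- The neighbours in a graph with 26 vertices. -/
def neighborsOnTwentySix : Fin 26 → Fin 3 → Fin 26 :=
  tableNbr 26
    1949229743796146313450918082595589479479103791688444236751088562500412050851110371580671020599447272467107839508224065

theorem isTable_neighborsOnTwentySix : IsTable neighborsOnTwentySix := by
  decide +kernel

theorem admissible_onTwentySix :
    Admissible (ofTable _ isTable_neighborsOnTwentySix) ![8, 7, 17, 18] :=
  admissible_of_table isTable_neighborsOnTwentySix ![8, 7, 17, 18]
    (by decide +kernel) (by decide +kernel)
    [[], [0], [0], [2], [3], [1, 4], [0, 4], [2], [5, 7], [3], [9], [10], [1, 11], [9], [12, 13],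
      [10, 14], [6, 15], [11], [13, 17], [18], [7, 19], [17], [8, 21], [19, 22], [20, 21],
      [16, 23, 24]]
    rfl (by decide +kernel) (by decide +kernel)
    [(10, 15), (16, 15), (14, 15), (14, 13), (14, 12), (1, 12), (11, 12), (10, 11), (9, 10),
      (17, 11), (9, 13), (3, 9), (13, 18), (3, 4), (3, 2), (2, 0), (2, 7), (0, 1), (1, 5), (6, 0),
      (6, 4), (16, 6), (4, 5), (16, 25), (8, 5), (17, 18), (19, 18), (21, 17), (8, 7), (7, 20),
      (8, 22), (21, 22), (23, 22), (21, 24), (19, 20), (23, 19), (23, 25), (24, 25), (24, 20)]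
    (by decide +kernel) (by decide +kernel) (by decide +kernel)
    [(3, 2), (2, 7), (2, 0), (3, 4), (3, 9), (4, 5), (6, 4), (6, 0), (16, 6), (0, 1), (1, 5),
      (1, 12), (8, 5), (16, 15), (16, 25), (10, 15), (14, 15), (14, 12), (11, 12), (14, 13),
      (10, 11), (9, 10), (9, 13), (17, 11), (13, 18), (17, 18), (21, 17), (19, 18), (23, 25),
      (24, 25), (23, 19), (23, 22), (19, 20), (21, 24), (21, 22), (24, 20), (8, 22), (7, 20)]
    (by decide +kernel) (by decide +kernel) (by decide +kernel)
    [(0, 1, 34666890082040590448167731088290639785499181056),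
      (0, 2, 47838431030519454027421220732136178091229710592),
      (0, 6, 52192287752482352581791115577272515975978780928),
      (1, 5, 12991677455300010643317370810466250014985424932),
      (1, 12, 34666890082040590704421300095702437034038792228),
      (2, 3, 8772738150985575304679733640110960618183399716),
      (2, 7, 8705834655224479706188816560652403181797792036),
      (3, 4, 34801807499689053916090806733084584541824357924),
      (3, 9, 12991677455299021875912577279315399361547082020),
      (4, 5, 26095204481890517589620071223826985824201251108),
      (4, 6, 12991677455299021371295455377477319936759175460),
      (5, 8, 26095204481890517589620071223824426148349221156),
      (6, 16, 12990583613892937094986566003300179231452043556),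
      (7, 20, 8705834660598831217076966939629385018825120036),
      (8, 22, 8703564287840599243573671646254158271892035876),
      (9, 10, 12990583613892937430468316631173474981762963748),
      (9, 13, 8703613798926811913228048694136647061348686116),
      (10, 11, 26228994884649375241068698901192965837990009124),
      (10, 15, 12990583613892937439655189696072880470435698980),
      (11, 12, 8703613798926811905280041408790300954378508580),
      (11, 17, 12990583613891933451197466907890868525279090980),
      (12, 14, 26228994884649375233002708759380257846579042596),
      (13, 14, 47905317941561351332459991604295802834233989412),
      (13, 18, 26228994884646424142577084457538144897603868964),
      (14, 15, 12990583613892937431627978742373782467461126436),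
      (15, 16, 13058580951060116891796149999194969921941543204),
      (16, 25, 135994747247899034722290254797253134150408484),
      (17, 21, 26094060627066738238332924686294467541451544868),
      (18, 19, 8770500709993681174401699863858011994741414180),
      (19, 20, 34800697061460202173063892935522909881608837412),
      (19, 23, 8704359190855873295023169013663204797005830436),
      (20, 24, 26138663600823971417790819034360443084383328548),
      (21, 22, 8772743680574113572712189395481925881756260644),
      (21, 24, 34645699495910133865136582657539955320788490532),
      (22, 23, 26091927141082487976266754418431004983518435620),
      (23, 25, 49262379353179327187062102048812725786515740964),
      (24, 25, 14396624386913155652217727869967502289310718244)]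
    (by decide +kernel) (by decide +kernel)
    ![52192287752483326385752226875018971523922302086,
      52192287752482368045965771231621551702418166918,
      34666890082040575492555224499721923011327595654,
      52192287752483326385811091172959405285879978276,
      52123163404468677715785024149494729800709346438,
      52190066900226888141505287203880490347948184710]
    (by decide +kernel) (by decide +kernel)
    ![0, 1, 5, 4, 6] (by decide +kernel) (by decide +kernel)

/-- The neighbours in a graph with 28 vertices. -/
def neighborsOnTwentyEight : Fin 28 → Fin 3 → Fin 28 :=
  tableNbr 28
    2267989474981705426579134175072040018219066186831484765418597736630423546725487687039135668107621565448366120489858906642717793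

theorem isTable_neighborsOnTwentyEight : IsTable neighborsOnTwentyEight := by
  decide +kernel

theorem admissible_onTwentyEight :
    Admissible (ofTable _ isTable_neighborsOnTwentyEight) ![10, 9, 12, 11] :=
  admissible_of_table isTable_neighborsOnTwentyEight ![10, 9, 12, 11]
    (by decide +kernel) (by decide +kernel)
    [[], [0], [1], [0], [2, 3], [2], [3, 5], [0, 5], [1], [8], [4, 9], [6], [11], [10, 12], [13],
      [8, 14], [11, 14], [16], [15, 17], [7, 17], [9], [20], [12, 21], [21], [18, 23], [19, 23],
      [20, 24], [22, 25, 26]]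
    rfl (by decide +kernel) (by decide +kernel)
    [(21, 20), (22, 21), (21, 23), (20, 26), (9, 20), (12, 22), (22, 27), (27, 26), (25, 27),
      (24, 26), (24, 23), (25, 23), (18, 24), (19, 25), (19, 17), (19, 7), (17, 18), (15, 18),
      (16, 17), (12, 13), (12, 11), (16, 11), (16, 14), (11, 6), (14, 15), (14, 13), (8, 15),
      (10, 13), (10, 9), (8, 9), (10, 4), (8, 1), (3, 4), (2, 4), (2, 1), (0, 1), (2, 5), (3, 0),
      (7, 0), (7, 5), (5, 6), (3, 6)]
    (by decide +kernel) (by decide +kernel) (by decide +kernel)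
    [(22, 27), (27, 26), (25, 27), (20, 26), (24, 26), (9, 20), (21, 20), (22, 21), (21, 23),
      (12, 22), (24, 23), (25, 23), (18, 24), (19, 25), (19, 7), (19, 17), (17, 18), (16, 17),
      (15, 18), (12, 11), (12, 13), (16, 11), (16, 14), (11, 6), (14, 13), (14, 15), (8, 15),
      (10, 13), (7, 5), (7, 0), (5, 6), (2, 5), (3, 6), (3, 0), (0, 1), (3, 4), (8, 1), (2, 1),
      (2, 4), (8, 9), (10, 4)]
    (by decide +kernel) (by decide +kernel) (by decide +kernel)
    [(0, 1, 213496477254929769447730281979182748035255383435776),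
      (0, 3, 141995649593458924168478591416110478108505336322304),
      (0, 7, 213496477254929769447730281979182748017647091325184),
      (1, 2, 141995581630563319529347036563804898865139126009892),
      (1, 8, 213496477254929831830401168069375547894662236094500),
      (2, 4, 213496477254929769447730281979182748009253711452452),
      (2, 5, 213496477254929769447730281979182748008831619717412),
      (3, 4, 35924629542020881157203818359395921416015640303908),
      (3, 6, 213496477254929829855038475536204106991067934890276),
      (4, 10, 213496477254929831830401168069377907217916471154980),
      (5, 6, 141995581630563318541548588907181427042755232998948),
      (5, 7, 141995649593458924168478591416110478100112962099492),
      (6, 11, 53209759718452436817753146142792130605397504825636),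
      (7, 19, 213496409292034184589987713609567723125560077228324),
      (8, 9, 53213910761203871040125421876172071916995204225316),
      (8, 15, 213496477254929769448194971877966753057960110663204),
      (9, 20, 53488276829360119793379196511754408886135939275044),
      (10, 13, 213496409292034040043494924739419832957863178148132),
      (11, 16, 35924629542020817787523855746702828177044804081956),
      (12, 13, 35924629542020817786968686759446397007431194777892),
      (12, 22, 35650331442203485105798980601882796869426451192100),
      (13, 14, 35924629542020817787206634834433720639660661020964),
      (14, 15, 213496409292034040043483604962540095758819559610660),
      (14, 16, 53213910761203870052013568072749561851422045509924),
      (15, 18, 213496409292034041356057215260915048875006959687972),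
      (16, 17, 213496409292034039037316115819840589465012056496420),
      (17, 18, 213496409292034039362166669522553164170642585950500),
      (17, 19, 141995649593458901405861535042745742217197998446884),
      (18, 24, 106880877187172836588227723335707390111233381636388),
      (19, 25, 53493991045597274422455326789617698616387429603620),
      (20, 21, 35933203462253442904710339047269258064489498417444),
      (20, 26, 214145059234371673185154480918992916701983894018340),
      (21, 22, 53214046648114079768766840106139858684337763784996),
      (21, 23, 35658905690129358796165954712464536171453018937636),
      (22, 27, 119147452785835017155767340946672629821382408411428),
      (23, 24, 141999733417423212461043898188414620390169260726564),
      (23, 25, 107421175094106742716065126262293987418539121056036),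
      (24, 26, 213596192249511283567107540943808662573763738868004),
      (25, 27, 548601519012555487746796493487815893178963597604),
      (26, 27, 59425627329290726310947853076086172103720820939044)]
    (by decide +kernel) (by decide +kernel)
    ![53213910761203871039891219096318039879333902885473,
      213496409292034040043494924120822105504068646869284,
      141999936562001938014175940075284130734451143874852,
      107433963177681840538287389190711699350672283682913,
      53214046686995327873471412378193663395486958166625,
      141999936562001938014172170918051504234930364293729]
    (by decide +kernel) (by decide +kernel)
    ![0, 1, 2, 4, 3] (by decide +kernel) (by decide +kernel)

/-- The neighbours in a graph with 30 vertices. -/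
def neighborsOnThirty : Fin 30 → Fin 3 → Fin 30 :=
  tableNbr 30
    2615619771501094024130965777057698893040318416680007853963189125067492564902762683161027989533110106925158860311109860758613212202539073

theorem isTable_neighborsOnThirty : IsTable neighborsOnThirty := by
  decide +kernel

theorem admissible_onThirty :
    Admissible (ofTable _ isTable_neighborsOnThirty) ![7, 8, 10, 9] :=
  admissible_of_table isTable_neighborsOnThirty ![7, 8, 10, 9]
    (by decide +kernel) (by decide +kernel)
    [[], [0], [0], [2], [3], [1, 4], [0, 4], [3], [1, 7], [5], [2, 9], [10], [11], [8, 12], [13],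
      [11, 14], [12], [14, 16], [15, 16], [18], [6, 19], [17, 20], [19], [22], [9, 23], [23],
      [21, 25], [22, 26], [24, 27], [7, 25, 28]]
    rfl (by decide +kernel) (by decide +kernel)
    [(14, 15), (14, 13), (17, 14), (18, 15), (11, 15), (10, 11), (11, 12), (13, 12), (8, 13),
      (16, 12), (17, 16), (18, 16), (19, 18), (21, 17), (22, 19), (19, 20), (21, 20), (6, 20),
      (26, 21), (22, 23), (22, 27), (26, 27), (27, 28), (26, 25), (25, 23), (23, 24), (25, 29),
      (29, 28), (28, 24), (24, 9), (7, 29), (7, 8), (7, 3), (1, 8), (10, 9), (5, 9), (2, 10),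
      (2, 3), (4, 3), (2, 0), (6, 4), (5, 4), (5, 1), (1, 0), (6, 0)]
    (by decide +kernel) (by decide +kernel) (by decide +kernel)
    [(25, 29), (7, 29), (29, 28), (26, 25), (25, 23), (26, 21), (26, 27), (27, 28), (28, 24),
      (22, 27), (23, 24), (22, 23), (22, 19), (24, 9), (19, 20), (19, 18), (21, 20), (6, 20),
      (21, 17), (18, 15), (18, 16), (17, 16), (16, 12), (17, 14), (14, 15), (11, 15), (14, 13),
      (11, 12), (13, 12), (8, 13), (10, 11), (10, 9), (2, 10), (5, 9), (6, 4), (6, 0), (2, 0),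
      (1, 0), (2, 3), (4, 3), (5, 4), (5, 1), (1, 8), (7, 3)]
    (by decide +kernel) (by decide +kernel) (by decide +kernel)
    [(0, 1, 874412253901441411723828258593824791701079806313906176),
      (0, 2, 437804882229935638018693289447321606518071207275792640),
      (0, 6, 440187590293489248668185443803764369863114334181886208),
      (1, 5, 874412253901441690920061291963568612114556314110267428),
      (1, 8, 803767997239634653468797726717229920768864142664798244),
      (2, 3, 440187590293489798969413755979300266878768533844597028),
      (2, 10, 440187590293489798968454479670147661283678858934245668),
      (3, 4, 803767997239634653468797726717229920771423799131379236),
      (3, 7, 874412253901441690920061291963568612112827891589454116),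
      (4, 5, 437804882229935913168812354407188336375539168346413348),
      (4, 6, 440187311917469872299926611915544656654228757072189732),
      (5, 9, 437804882229935913168812354407188329295880541337426212),
      (6, 20, 437804882229935640733614350534002870663839659696101668),
      (7, 29, 2388468361751078969799727889745470990717406515697956),
      (8, 13, 875604025497248374112204632852101593958674690167937316),
      (9, 24, 802595690550917358375962118388601078639561553619327268),
      (10, 11, 803768275615654300942067290383645891380682757021767972),
      (11, 12, 803767997239634653467853903380466540330815386513709348),
      (11, 15, 803767997239634653468797729246602518111405977503930660),
      (12, 13, 803767997239634653468797726715081451604139012328134948),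
      (12, 16, 874412253901441415769957751669706376997119327804201252),
      (13, 14, 803767997239634653467853899542157168140696050809837860),
      (14, 15, 803767997239634653467823002462963160280828537310681380),
      (14, 17, 803767997239634653468808104963602356904747346829646116),
      (15, 18, 803767997239634653465905565260023821642386755088947492),
      (16, 17, 803767997239634653468792735055612117385544048152025380),
      (16, 18, 803767997239634653465905645726198096133063206268705060),
      (17, 21, 803767997239635280747517000601509151927815872082745636),
      (18, 19, 437804882229935646133278546286545020445201381099444516),
      (19, 20, 219086633138705111933414927090228340091535998726576420),
      (19, 22, 874431162078786538114794540727953029509753667371276580),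
      (20, 21, 440187590293489155565684606825084783515061687653898532),
      (21, 26, 802576690984082422096137752607161061343642514745334052),
      (22, 23, 803768275547364255807088779905414256436182983252252964),
      (22, 27, 219111387322691849372316905706990430691942763626371364),
      (23, 24, 217895418316874234105651429142493824009077048032237860),
      (23, 25, 802595407898729819083486291022637797679528062380808484),
      (24, 28, 215562861170980706504001499843711834876843317586434340),
      (25, 26, 219086543227309875813089998860256001325380075718318372),
      (25, 29, 416242348831987128347533300998718791194449227984017700),
      (26, 27, 803762059889150595365507666608754609553523594105067812),
      (27, 28, 437436583414967498277154327929703925006701944573040932),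
      (28, 29, 119781868373125671197808594045423043243773198467209508)]
    (by decide +kernel) (by decide +kernel)
    ![802577060771887726011448913248701713390542884562932102,
      803768275615654843151098571686998186205131200617648518,
      874412253901441415769926774030376961216087361099022945,
      874412810653480985868534424889872141782380012026561682,
      802577060771887726010505089912874038275958972802474569,
      803768275615654843151098571686998189645881299822518857]
    (by decide +kernel) (by decide +kernel)
    ![0, 1, 5, 4, 6] (by decide +kernel) (by decide +kernel)

end Base

/-- There is a graph with `N` vertices to which the dot product with the Petersen graph can be
applied repeatedly. -/
def HasAdmissible (N : ℕ) : Prop :=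
  ∃ (V : Type) (_ : Fintype V) (G : SimpleGraph V) (m : Fin 4 → V),
    Fintype.card V = N ∧ Admissible G m

theorem HasAdmissible.add_eight {N : ℕ} (h : HasAdmissible N) : HasAdmissible (N + 8) := by
  obtain ⟨V, _, G, m, rfl, hG⟩ := h
  exact ⟨V ⊕ Fin 8, inferInstance, dot G m, newMark, by simp, hG.dot⟩

theorem HasAdmissible.exists_isGood {N : ℕ} (h : HasAdmissible N) :
    ∃ G : SimpleGraph (Fin (N + 8)), IsGood G := by
  obtain ⟨V, _, G, m, hN, hG⟩ := h
  let e : V ⊕ Fin 8 ≃ Fin (N + 8) := Fintype.equivFinOfCardEq (by simp [hN])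
  exact ⟨_, hG.dot_isGood.of_iso (SimpleGraph.Iso.map e _)⟩

theorem hasAdmissible_of_even (N : ℕ) (hN : Even N) (h : 24 ≤ N) : HasAdmissible N := by
  induction N using Nat.strong_induction_on with
  | _ N ih =>
    by_cases hlt : N < 32
    · obtain ⟨k, rfl⟩ := hN
      have : k = 12 ∨ k = 13 ∨ k = 14 ∨ k = 15 := by omega
      rcases this with rfl | rfl | rfl | rfl
      · exact ⟨_, _, _, _, Fintype.card_fin _, admissible_onTwentyFour⟩
      · exact ⟨_, _, _, _, Fintype.card_fin _, admissible_onTwentySix⟩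
      · exact ⟨_, _, _, _, Fintype.card_fin _, admissible_onTwentyEight⟩
      · exact ⟨_, _, _, _, Fintype.card_fin _, admissible_onThirty⟩
    · obtain ⟨M, rfl⟩ := Nat.exists_eq_add_of_le' (show 8 ≤ N by omega)
      exact (ih M (by omega) (by simpa [Nat.even_add, show Even 8 by decide] using hN)
        (by omega)).add_eight

end SnarkFamily

/-- For every even integer `n ≥ 32` there exists a strictly critical
snark of order `n` whose cyclic connectivity equals 4. -/
theorem exists_strictlyCritical_snark_cyclicConnectivity_four
    (n : ℕ) (hn : Even n) (hn32 : 32 ≤ n) :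
    ∃ G : SimpleGraph (Fin n),
      IsSnark G ∧ StrictlyCritical G ∧ cyclicConnectivity G = 4 := by
  obtain ⟨N, rfl⟩ := Nat.exists_eq_add_of_le' (show 8 ≤ n by omega)
  obtain ⟨G, hG⟩ := (SnarkFamily.hasAdmissible_of_even N
    (by simpa [Nat.even_add, show Even 8 by decide] using hn) (by omega)).exists_isGood
  exact ⟨G, hG.conclusion⟩
end
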